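/- arXiv:1408.1862 — 2 statements merged into one kernel-verified Lean document; each statement's English description precedes it below -/
import Mathlib

section
/- For every integer N ≥ 0 there exist rational numbers a_N and b_N such that ∫_0^1 ∫_0^1 ∫_0^1 ( x·y·z·(1−x)·(1−y)·(1−z) / (1−(1−x·y)·z) )^N · (1/(1−(1−x·y)·z)) dx dy dz = a_N + b_N·ζ(3), the integral converging absolutely. (These are the basic cellular integrals for n = 6 and σ = (1,3,6,4,2,5), which reproduce the linear forms in 1 and ζ(3) from Apéry's irrationality proof of ζ(3).) -/
open MeasureTheory

/-- `ζ(3) = Σ_{k≥1} 1/k³`. -/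
noncomputable def zeta3 : ℝ := ∑' k : ℕ, 1 / ((k : ℝ) + 1) ^ 3

/-- Lebesgue measure on the open unit interval. -/
noncomputable def nuI : Measure ℝ := volume.restrict (Set.Ioo (0:ℝ) 1)

instance : IsFiniteMeasure nuI := by unfold nuI; infer_instance

lemma nuI_integral (f : ℝ → ℝ) : ∫ x, f x ∂nuI = ∫ x in (0:ℝ)..1, f x := by
  unfold nuI
  rw [intervalIntegral.integral_of_le zero_le_one, integral_Ioc_eq_integral_Ioo]

lemma nuI_integrable {f : ℝ → ℝ} (h : IntervalIntegrable f volume 0 1) : Integrable f nuI := by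
  unfold nuI
  rw [intervalIntegrable_iff_integrableOn_Ioo_of_le zero_le_one] at h
  exact h

lemma nuI_ae : ∀ᵐ x ∂nuI, x ∈ Set.Ioo (0:ℝ) 1 := by
  unfold nuI
  exact ae_restrict_mem measurableSet_Ioo

lemma parts_one (W : Polynomial ℝ) (h0 : W.eval 0 = 0) (h1 : W.eval 1 = 0) (a b : ℝ)
    (ha : 0 < a) (hb : 0 < b) (m : ℕ) :
    ∫ x in (0:ℝ)..1, (Polynomial.derivative W).eval x / (a + b * x) ^ (m + 1) =
      (m + 1) * b * ∫ x in (0:ℝ)..1, W.eval x / (a + b * x) ^ (m + 2) := by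
  have hpos : ∀ x ∈ Set.uIcc (0:ℝ) 1, a + b * x ≠ 0 := by
    intro x hx
    rw [Set.uIcc_of_le zero_le_one] at hx
    have := hx.1
    positivity
  have key := intervalIntegral.integral_mul_deriv_eq_deriv_mul (a := 0) (b := 1)
    (u := fun x => ((a + b * x) ^ (m + 1))⁻¹) (v := fun x => W.eval x)
    (u' := fun x => - ((m + 1) * b) / (a + b * x) ^ (m + 2))
    (v' := fun x => (Polynomial.derivative W).eval x) ?_ ?_ ?_ ?_
  · rw [h0, h1, mul_zero, mul_zero, sub_zero, zero_sub] at key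
    rw [← intervalIntegral.integral_const_mul]
    rw [← intervalIntegral.integral_neg] at key
    convert key using 1
    · apply intervalIntegral.integral_congr
      intro x hx
      simp only
      rw [div_eq_mul_inv, mul_comm]
    · apply intervalIntegral.integral_congr
      intro x hx
      simp only
      ring
  · intro x hx
    have h := ((((hasDerivAt_id x).const_mul b).const_add a).pow (m + 1)).inv
      (pow_ne_zero _ (hpos x hx))
    refine h.congr_deriv ?_
    have := hpos x hx
    simp only [id, Pi.pow_apply]
    field_simp
    push_cast
    simp
    ring
  · intro x hx
    exact W.hasDerivAt x
  · apply ContinuousOn.intervalIntegrable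
    apply ContinuousOn.div (by fun_prop) (by fun_prop)
    intro x hx
    exact pow_ne_zero _ (hpos x hx)
  · apply Continuous.intervalIntegrable
    fun_prop

lemma parts_many (k : ℕ) : ∀ (W : Polynomial ℝ)
    (_ : (Polynomial.X * (1 - Polynomial.X)) ^ k ∣ W) (a b : ℝ)
    (_ : 0 < a) (_ : 0 < b) (m : ℕ),
    (m.factorial : ℝ) *
      ∫ x in (0:ℝ)..1, ((Polynomial.derivative)^[k] W).eval x / (a + b * x) ^ (m + 1) =
      ((m + k).factorial : ℝ) * b ^ k *
        ∫ x in (0:ℝ)..1, W.eval x / (a + b * x) ^ (m + k + 1) := by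
  induction k with
  | zero => intro W _ a b ha hb m; simp
  | succ k ih =>
    intro W hW a b ha hb m
    have hd := Polynomial.pow_sub_one_dvd_derivative_of_pow_dvd hW
    rw [Nat.add_sub_cancel] at hd
    rw [Function.iterate_succ_apply, ih _ hd a b ha hb m]
    have hx : (Polynomial.X * (1 - Polynomial.X) : Polynomial ℝ) ∣ W :=
      (dvd_pow_self _ (Nat.succ_ne_zero k)).trans hW
    obtain ⟨Q, rfl⟩ := hx
    rw [parts_one _ (by simp) (by simp) a b ha hb]
    rw [show m + (k + 1) = (m + k) + 1 by ring, Nat.factorial_succ]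
    push_cast
    rw [show m + k + 1 + 1 = m + k + 2 by ring]
    ring

lemma subst_z (N : ℕ) (t : ℝ) (ht : 0 < t) (ht1 : t < 1) :
    ∫ z in (0:ℝ)..1, t ^ N * z ^ N / (1 - (1 - t) * z) ^ (N + 1) =
      ∫ w in (0:ℝ)..1, (1 - w) ^ N / (1 - (1 - t) * w) := by
  have hpos : ∀ x ∈ Set.Icc (0:ℝ) 1, 0 < 1 - (1 - t) * x := by
    intro x hx
    nlinarith [hx.1, hx.2]
  have key := intervalIntegral.integral_comp_mul_deriv' (a := 0) (b := 1)
    (f := fun w => (1 - w) / (1 - (1 - t) * w)) (f' := fun w => -t / (1 - (1 - t) * w) ^ 2)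
    (g := fun z => t ^ N * z ^ N / (1 - (1 - t) * z) ^ (N + 1)) ?_ ?_ ?_
  · simp only [Function.comp, sub_self, zero_div, mul_zero, sub_zero, div_one] at key
    rw [intervalIntegral.integral_symm 0 1, ← neg_eq_iff_eq_neg,
      ← intervalIntegral.integral_neg] at key
    rw [← key]
    apply intervalIntegral.integral_congr
    intro x hx
    rw [Set.uIcc_of_le zero_le_one] at hx
    have h := hpos x hx
    simp only
    have h2 : 1 - (1 - t) * ((1 - x) / (1 - (1 - t) * x)) = t / (1 - (1 - t) * x) := by
      rw [eq_div_iff h.ne', sub_mul, mul_assoc, div_mul_cancel₀ _ h.ne']; ring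
    rw [h2]
    generalize 1 - (1 - t) * x = E at *
    simp only [div_pow]
    field_simp
    ring
  · intro x hx
    rw [Set.uIcc_of_le zero_le_one] at hx
    have h := hpos x hx
    have := ((hasDerivAt_id x).const_sub 1).div (((hasDerivAt_id x).const_mul (1 - t)).const_sub 1) h.ne'
    refine this.congr_deriv ?_
    simp only [id]
    congr 1
    ring
  · apply ContinuousOn.div (by fun_prop) (by fun_prop)
    intro x hx
    rw [Set.uIcc_of_le zero_le_one] at hx
    exact pow_ne_zero _ (hpos x hx).ne'
  · apply ContinuousOn.div (by fun_prop) (by fun_prop)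
    rintro _ ⟨x, hx, rfl⟩
    rw [Set.uIcc_of_le zero_le_one] at hx
    have h := hpos x hx
    apply pow_ne_zero
    apply ne_of_gt
    apply hpos
    refine ⟨div_nonneg (by linarith [hx.2]) h.le, ?_⟩
    rw [div_le_one h]
    nlinarith [hx.1]

lemma int_log (t : ℝ) (ht : 0 < t) (ht1 : t < 1) :
    ∫ z in (0:ℝ)..1, 1 / (1 - (1 - t) * z) = - Real.log t / (1 - t) := by
  have hpos : ∀ x ∈ Set.uIcc (0:ℝ) 1, 0 < 1 - (1 - t) * x := by
    intro x hx
    rw [Set.uIcc_of_le zero_le_one] at hx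
    nlinarith [hx.1, hx.2]
  rw [intervalIntegral.integral_eq_sub_of_hasDerivAt
    (f := fun z => - Real.log (1 - (1 - t) * z) / (1 - t))]
  · simp
  · intro x hx
    have h := (((((hasDerivAt_id x).const_mul (1 - t)).const_sub 1).log (hpos x hx).ne').neg).div_const (1 - t)
    refine h.congr_deriv ?_
    have := hpos x hx
    have h3 : 1 - t ≠ 0 := by linarith
    simp only [id]
    field_simp
    try ring
  · apply ContinuousOn.intervalIntegrable
    apply ContinuousOn.div (by fun_prop) (by fun_prop)
    intro x hx
    exact (hpos x hx).ne'

lemma powlog_integrable (m : ℕ) : Integrable (fun x : ℝ => x ^ m * (- Real.log x)) nuI := by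
  apply nuI_integrable
  apply IntervalIntegrable.continuousOn_mul
  · exact intervalIntegral.intervalIntegrable_log'.neg
  · fun_prop

lemma pow_integrable (m : ℕ) : Integrable (fun x : ℝ => x ^ m) nuI := by
  apply nuI_integrable
  apply Continuous.intervalIntegrable
  fun_prop

lemma pow_integral (m : ℕ) : ∫ x : ℝ, x ^ m ∂nuI = 1 / (m + 1) := by
  rw [nuI_integral, integral_pow]; simp

lemma powlog_integral (m : ℕ) : ∫ x : ℝ, x ^ m * (- Real.log x) ∂nuI = 1 / (m + 1) ^ 2 := by
  rw [nuI_integral]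
  have hm : (m:ℝ) + 1 ≠ 0 := by positivity
  rw [intervalIntegral.integral_eq_sub_of_hasDerivAt_of_le (f := fun x =>
    x ^ (m + 1) / (m + 1) ^ 2 - x ^ m * (x * Real.log x) / (m + 1)) zero_le_one]
  · simp
  · have := Real.continuous_mul_log
    fun_prop
  · intro x hx
    have h1 := (hasDerivAt_pow (m + 1) x).div_const (((m:ℝ) + 1) ^ 2)
    have h2 := ((hasDerivAt_pow (m + 1) x).mul (Real.hasDerivAt_log hx.1.ne')).div_const ((m:ℝ) + 1)
    have h3 := h1.sub h2
    have h4 : (fun x : ℝ => x ^ (m + 1) / ((m:ℝ) + 1) ^ 2 - x ^ m * (x * Real.log x) / (m + 1)) =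
      (fun x : ℝ => x ^ (m + 1) / ((m:ℝ) + 1) ^ 2) - fun x => (((fun x : ℝ => x ^ (m + 1)) * Real.log : ℝ → ℝ) x) / ((m:ℝ) + 1) := by
      ext x
      simp only [Pi.sub_apply, Pi.mul_apply]
      ring
    rw [h4]
    refine h3.congr_deriv ?_
    have := hx.1.ne'
    simp only [Nat.add_sub_cancel]
    push_cast
    field_simp
    ring
  · have := powlog_integrable m
    unfold nuI at this
    rw [intervalIntegrable_iff_integrableOn_Ioo_of_le zero_le_one]
    exact this

/-- Lebesgue measure on the open unit cube. -/
noncomputable def nuC : Measure (ℝ × ℝ × ℝ) := nuI.prod (nuI.prod nuI)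

lemma nuC_eq : nuC = volume.restrict
    (Set.Ioo (0:ℝ) 1 ×ˢ Set.Ioo (0:ℝ) 1 ×ˢ Set.Ioo (0:ℝ) 1) := by
  unfold nuC nuI
  rw [Measure.prod_restrict, Measure.prod_restrict]
  rfl

lemma nuC_ae : ∀ᵐ p ∂nuC, p.1 ∈ Set.Ioo (0:ℝ) 1 ∧ p.2.1 ∈ Set.Ioo (0:ℝ) 1 ∧
    p.2.2 ∈ Set.Ioo (0:ℝ) 1 := by
  rw [nuC_eq]
  exact ae_restrict_mem (measurableSet_Ioo.prod (measurableSet_Ioo.prod measurableSet_Ioo))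

lemma nuS_ae : ∀ᵐ p ∂(nuI.prod nuI), p.1 ∈ Set.Ioo (0:ℝ) 1 ∧ p.2 ∈ Set.Ioo (0:ℝ) 1 := by
  unfold nuI
  rw [Measure.prod_restrict]
  exact ae_restrict_mem (measurableSet_Ioo.prod measurableSet_Ioo)

lemma lem_X {f g : ℝ × ℝ × ℝ → ℝ} (hf : Integrable f nuC) (hg : Integrable g nuC)
    (h : ∀ y ∈ Set.Ioo (0:ℝ) 1, ∀ z ∈ Set.Ioo (0:ℝ) 1,
      ∫ x in (0:ℝ)..1, f (x, y, z) = ∫ x in (0:ℝ)..1, g (x, y, z)) :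
    ∫ p, f p ∂nuC = ∫ p, g p ∂nuC := by
  unfold nuC at *
  rw [integral_prod_symm _ hf, integral_prod_symm _ hg]
  apply integral_congr_ae
  filter_upwards [nuS_ae] with q hq
  rw [nuI_integral, nuI_integral]
  exact h q.1 hq.1 q.2 hq.2

lemma lem_Y {f g : ℝ × ℝ × ℝ → ℝ} (hf : Integrable f nuC) (hg : Integrable g nuC)
    (h : ∀ x ∈ Set.Ioo (0:ℝ) 1, ∀ z ∈ Set.Ioo (0:ℝ) 1,
      ∫ y in (0:ℝ)..1, f (x, y, z) = ∫ y in (0:ℝ)..1, g (x, y, z)) :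
    ∫ p, f p ∂nuC = ∫ p, g p ∂nuC := by
  unfold nuC at *
  rw [integral_prod _ hf, integral_prod _ hg]
  apply integral_congr_ae
  filter_upwards [nuI_ae, hf.prod_right_ae, hg.prod_right_ae] with x hx hfx hgx
  rw [integral_prod_symm _ hfx, integral_prod_symm _ hgx]
  apply integral_congr_ae
  filter_upwards [nuI_ae] with z hz
  rw [nuI_integral, nuI_integral]
  exact h x hx z hz

lemma lem_Z' {f : ℝ × ℝ × ℝ → ℝ} {g : ℝ × ℝ → ℝ} (hf : Integrable f nuC)
    (h : ∀ x ∈ Set.Ioo (0:ℝ) 1, ∀ y ∈ Set.Ioo (0:ℝ) 1,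
      ∫ z in (0:ℝ)..1, f (x, y, z) = g (x, y)) :
    ∫ p, f p ∂nuC = ∫ p, g p ∂(nuI.prod nuI) := by
  unfold nuC at hf ⊢
  have e := (measurePreserving_prodAssoc nuI nuI nuI).symm
  have hf' : Integrable (f ∘ MeasurableEquiv.prodAssoc) ((nuI.prod nuI).prod nuI) :=
    (measurePreserving_prodAssoc nuI nuI nuI).integrable_comp_of_integrable hf
  rw [← (measurePreserving_prodAssoc nuI nuI nuI).integral_comp
    MeasurableEquiv.prodAssoc.measurableEmbedding]
  have := integral_prod _ hf'
  simp only [Function.comp] at this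
  rw [this]
  apply integral_congr_ae
  filter_upwards [nuS_ae] with q hq
  rw [nuI_integral]
  exact h q.1 hq.1 q.2 hq.2

lemma lem_Z {f g : ℝ × ℝ × ℝ → ℝ} (hf : Integrable f nuC) (hg : Integrable g nuC)
    (h : ∀ x ∈ Set.Ioo (0:ℝ) 1, ∀ y ∈ Set.Ioo (0:ℝ) 1,
      ∫ z in (0:ℝ)..1, f (x, y, z) = ∫ z in (0:ℝ)..1, g (x, y, z)) :
    ∫ p, f p ∂nuC = ∫ p, g p ∂nuC := by
  rw [lem_Z' (g := fun q => ∫ z in (0:ℝ)..1, g (q.1, q.2, z)) hf h,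
    lem_Z' (g := fun q => ∫ z in (0:ℝ)..1, g (q.1, q.2, z)) hg (fun _ _ _ _ => rfl)]

lemma den_bounds {x y z : ℝ} (hx : x ∈ Set.Ioo (0:ℝ) 1) (hy : y ∈ Set.Ioo (0:ℝ) 1)
    (hz : z ∈ Set.Ioo (0:ℝ) 1) : 0 < 1 - (1 - x * y) * z ∧ x * y ≤ 1 - (1 - x * y) * z ∧
      1 - z ≤ 1 - (1 - x * y) * z ∧ x * y * z ≤ 1 - (1 - x * y) * z := by
  obtain ⟨hx0, hx1⟩ := hx
  obtain ⟨hy0, hy1⟩ := hy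
  obtain ⟨hz0, hz1⟩ := hz
  have h1 : 0 < x * y := mul_pos hx0 hy0
  have h2 : x * y < 1 := by nlinarith
  have h3 : 0 < x * y * z := mul_pos h1 hz0
  refine ⟨by nlinarith, by nlinarith, by nlinarith, by nlinarith⟩

lemma rpow_int : Integrable (fun x : ℝ => x ^ (-(1/2) : ℝ)) nuI :=
  nuI_integrable (intervalIntegral.intervalIntegrable_rpow' (by norm_num))

lemma rpow_int' : Integrable (fun x : ℝ => (1 - x) ^ (-(1/2) : ℝ)) nuI := by
  apply nuI_integrable
  have := (intervalIntegral.intervalIntegrable_rpow' (a := 0) (b := 1) (r := (-(1/2) : ℝ))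
    (by norm_num)).comp_sub_left 1
  simpa using this.symm

lemma base_int : Integrable (fun p : ℝ × ℝ × ℝ => 1 / (1 - (1 - p.1 * p.2.1) * p.2.2)) nuC := by
  have h : Integrable (fun p : ℝ × ℝ × ℝ => p.1 ^ (-(1/2) : ℝ) *
      (p.2.1 ^ (-(1/2) : ℝ) * (1 - p.2.2) ^ (-(1/2) : ℝ))) nuC :=
    rpow_int.mul_prod (rpow_int.mul_prod rpow_int')
  refine h.mono' ?_ ?_
  · apply Measurable.aestronglyMeasurable
    fun_prop
  · filter_upwards [nuC_ae] with p hp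
    obtain ⟨x, y, z⟩ := p
    obtain ⟨hx, hy, hz⟩ := hp
    simp only at *
    obtain ⟨h1, h2, h3, -⟩ := den_bounds hx hy hz
    have hz1 : 0 < 1 - z := by linarith [hz.2]
    rw [Real.norm_of_nonneg (by positivity), ← Real.mul_rpow hy.1.le hz1.le,
      ← Real.mul_rpow hx.1.le (mul_pos hy.1 hz1).le, Real.rpow_neg (by
        have := hx.1; have := hy.1; positivity), ← Real.sqrt_eq_rpow, one_div]
    have hp : 0 < x * (y * (1 - z)) := mul_pos hx.1 (mul_pos hy.1 hz1)
    apply inv_anti₀ (Real.sqrt_pos.mpr hp)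
    rw [Real.sqrt_le_left h1.le]
    nlinarith [mul_pos hx.1 hy.1]

lemma dom_int (g : ℝ × ℝ × ℝ → ℝ) (hg : Measurable g) (C : ℝ)
    (hC : ∀ x ∈ Set.Ioo (0:ℝ) 1, ∀ y ∈ Set.Ioo (0:ℝ) 1, ∀ z ∈ Set.Ioo (0:ℝ) 1,
      |g (x, y, z)| ≤ C) :
    Integrable (fun p : ℝ × ℝ × ℝ => g p * (1 / (1 - (1 - p.1 * p.2.1) * p.2.2))) nuC := by
  apply base_int.bdd_mul (c := C) hg.aestronglyMeasurable
  filter_upwards [nuC_ae] with p hp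
  exact hC _ hp.1 _ hp.2.1 _ hp.2.2

/-- The rational span of `1` and `ζ(3)`. -/
noncomputable def spanZ : Submodule ℚ ℝ := Submodule.span ℚ {1, zeta3}

lemma rat_mem (q : ℚ) : (q : ℝ) ∈ spanZ := by
  unfold spanZ
  rw [Submodule.mem_span_pair]
  exact ⟨q, 0, by simp [Rat.smul_def]⟩

lemma zeta3_mem : zeta3 ∈ spanZ := Submodule.subset_span (by simp)

lemma summable_shift (r p : ℕ) (hp : 1 < p) :
    Summable (fun k : ℕ => 1 / ((k : ℝ) + r + 1) ^ p) := by
  have h := (summable_nat_add_iff (r + 1)).mpr (Real.summable_one_div_nat_pow.mpr hp)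
  refine h.congr ?_
  intro k
  push_cast
  rw [add_assoc]

/-- The terms of the series for the basic integrals. -/
noncomputable def zterm (r s k : ℕ) : ℝ :=
  1 / ((k : ℝ) + r + 1) ^ 2 * (1 / ((k : ℝ) + s + 1)) +
    1 / ((k : ℝ) + r + 1) * (1 / ((k : ℝ) + s + 1) ^ 2)

lemma zterm_symm (r s k : ℕ) : zterm r s k = zterm s r k := by
  unfold zterm; ring

lemma zterm_lt (r d : ℕ) : Summable (zterm r (r + (d + 1))) ∧
    ∑' k, zterm r (r + (d + 1)) k ∈ spanZ := by
  have hs := summable_shift r 2 one_lt_two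
  have hs' := (summable_nat_add_iff (d + 1)).mpr hs
  have ht : ∀ k, zterm r (r + (d + 1)) k = (1 / ((d : ℝ) + 1)) *
      (1 / ((k : ℝ) + r + 1) ^ 2 - 1 / (((k + (d + 1) : ℕ) : ℝ) + r + 1) ^ 2) := by
    intro k
    unfold zterm
    have h1 : (k : ℝ) + r + 1 ≠ 0 := by positivity
    have h2 : (d : ℝ) + 1 ≠ 0 := by positivity
    have h3 : (k : ℝ) + (r + (d + 1)) + 1 ≠ 0 := by positivity
    have h4 : (k : ℝ) + (d + 1) + r + 1 ≠ 0 := by positivity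
    push_cast
    field_simp
    ring
  have hfun : zterm r (r + (d + 1)) = fun k : ℕ => (1 / ((d : ℝ) + 1)) *
      (1 / ((k : ℝ) + r + 1) ^ 2 - 1 / (((k + (d + 1) : ℕ) : ℝ) + r + 1) ^ 2) := funext ht
  rw [hfun]
  refine ⟨(hs.sub hs').mul_left _, ?_⟩
  rw [tsum_mul_left, hs.tsum_sub hs', ← hs.sum_add_tsum_nat_add (d + 1), add_sub_cancel_right]
  have := rat_mem (1 / ((d : ℚ) + 1) * ∑ i ∈ Finset.range (d + 1), 1 / ((i : ℚ) + r + 1) ^ 2)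
  push_cast at this
  exact this

lemma zterm_eq (r : ℕ) : Summable (zterm r r) ∧ ∑' k, zterm r r k ∈ spanZ := by
  have hs := summable_shift r 3 (by norm_num)
  have hfun : zterm r r = fun k : ℕ => 2 * (1 / ((k : ℝ) + r + 1) ^ 3) := by
    ext k
    unfold zterm
    have h1 : (k : ℝ) + r + 1 ≠ 0 := by positivity
    field_simp
    ring
  rw [hfun]
  refine ⟨hs.mul_left _, ?_⟩
  rw [tsum_mul_left]
  have h0 := summable_shift 0 3 (by norm_num)
  simp only [Nat.cast_zero, add_zero] at h0
  have h1 := h0.sum_add_tsum_nat_add r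
  have h2 : ∑' k : ℕ, 1 / ((k : ℝ) + r + 1) ^ 3 =
      zeta3 - ((∑ i ∈ Finset.range r, 1 / ((i : ℚ) + 1) ^ 3 : ℚ) : ℝ) := by
    unfold zeta3
    rw [← h1]
    push_cast
    ring
  rw [h2]
  have := spanZ.smul_mem 2 (spanZ.sub_mem zeta3_mem
    (rat_mem (∑ i ∈ Finset.range r, 1 / ((i : ℚ) + 1) ^ 3 : ℚ)))
  rw [Rat.smul_def] at this
  exact_mod_cast this

lemma zterm_all (r s : ℕ) : Summable (zterm r s) ∧ ∑' k, zterm r s k ∈ spanZ := by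
  rcases lt_trichotomy r s with h | h | h
  · obtain ⟨d, rfl⟩ := Nat.exists_eq_add_of_lt h
    exact zterm_lt r d
  · subst h; exact zterm_eq r
  · obtain ⟨d, rfl⟩ := Nat.exists_eq_add_of_lt h
    rw [show zterm (s + d + 1) s = zterm s (s + d + 1) from funext fun k => zterm_symm _ _ _]
    exact zterm_lt s d

/-- The terms of the expansion in powers of `xy`. -/
noncomputable def fk (r s k : ℕ) (q : ℝ × ℝ) : ℝ :=
  q.1 ^ (k + r) * (- Real.log q.1) * q.2 ^ (k + s) + q.1 ^ (k + r) * (q.2 ^ (k + s) * (- Real.log q.2))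

lemma fk_int (r s k : ℕ) : Integrable (fk r s k) (nuI.prod nuI) :=
  ((powlog_integrable (k + r)).mul_prod (pow_integrable (k + s))).add
    ((pow_integrable (k + r)).mul_prod (powlog_integrable (k + s)))

lemma fk_integral (r s k : ℕ) : ∫ q, fk r s k q ∂(nuI.prod nuI) = zterm r s k := by
  unfold fk zterm
  rw [integral_add ((powlog_integrable (k + r)).mul_prod (pow_integrable (k + s)))
    ((pow_integrable (k + r)).mul_prod (powlog_integrable (k + s)))]
  rw [integral_prod_mul (fun x : ℝ => x ^ (k + r) * (- Real.log x)) (fun y : ℝ => y ^ (k + s)),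
    integral_prod_mul (fun x : ℝ => x ^ (k + r)) (fun y : ℝ => y ^ (k + s) * (- Real.log y)),
    powlog_integral, powlog_integral, pow_integral, pow_integral]
  push_cast
  rfl

lemma fk_nonneg (r s k : ℕ) {x y : ℝ} (hx : x ∈ Set.Ioo (0:ℝ) 1) (hy : y ∈ Set.Ioo (0:ℝ) 1) :
    0 ≤ fk r s k (x, y) := by
  have h1 := Real.log_neg hx.1 hx.2
  have h2 := Real.log_neg hy.1 hy.2
  have := hx.1
  have := hy.1
  have : 0 ≤ - Real.log x := by linarith
  have : 0 ≤ - Real.log y := by linarith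
  unfold fk
  simp only
  positivity

lemma fk_tsum (r s : ℕ) {x y : ℝ} (hx : x ∈ Set.Ioo (0:ℝ) 1) (hy : y ∈ Set.Ioo (0:ℝ) 1) :
    ∑' k, fk r s k (x, y) = x ^ r * y ^ s * (- Real.log (x * y) / (1 - x * y)) := by
  have h0 : 0 < x * y := mul_pos hx.1 hy.1
  have h1 : x * y < 1 := by nlinarith [hx.1, hx.2, hy.1, hy.2]
  have h : ∀ k, fk r s k (x, y) = x ^ r * y ^ s * (- Real.log (x * y)) * (x * y) ^ k := by
    intro k
    unfold fk
    rw [Real.log_mul hx.1.ne' hy.1.ne']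
    simp only
    rw [mul_pow]
    ring
  simp_rw [h]
  rw [tsum_mul_left, tsum_geometric_of_lt_one h0.le h1]
  rw [div_eq_mul_inv]
  ring

lemma mono_mem (r s : ℕ) :
    ∫ p, p.1 ^ r * p.2.1 ^ s * (1 / (1 - (1 - p.1 * p.2.1) * p.2.2)) ∂nuC ∈ spanZ := by
  have hint : Integrable (fun p : ℝ × ℝ × ℝ => p.1 ^ r * p.2.1 ^ s *
      (1 / (1 - (1 - p.1 * p.2.1) * p.2.2))) nuC := by
    apply dom_int (fun p : ℝ × ℝ × ℝ => p.1 ^ r * p.2.1 ^ s) (by fun_prop) 1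
    intro x hx y hy z hz
    have h1 := pow_le_one₀ hx.1.le hx.2.le (n := r)
    have h2 := pow_le_one₀ hy.1.le hy.2.le (n := s)
    have h3 := pow_pos hx.1 r
    have h4 := pow_pos hy.1 s
    simp only
    rw [abs_of_pos (by positivity)]
    nlinarith
  rw [lem_Z' (g := fun q => ∑' k, fk r s k q) hint]
  · have h := hasSum_integral_of_summable_integral_norm (fk_int r s) ?_
    · simp_rw [fk_integral] at h
      rw [← h.tsum_eq]
      exact (zterm_all r s).2
    · refine (zterm_all r s).1.congr ?_
      intro k
      rw [← fk_integral]
      apply integral_congr_ae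
      filter_upwards [nuS_ae] with q hq
      rw [Real.norm_of_nonneg (fk_nonneg r s k hq.1 hq.2)]
  · intro x hx y hy
    simp only
    have h0 : 0 < x * y := mul_pos hx.1 hy.1
    have h1 : x * y < 1 := by nlinarith [hx.1, hx.2, hy.1, hy.2]
    rw [fk_tsum r s hx hy, intervalIntegral.integral_const_mul, int_log _ h0 h1]

lemma poly_bdd (P : Polynomial ℝ) : ∃ C, 0 ≤ C ∧ ∀ x ∈ Set.Ioo (0:ℝ) 1, |P.eval x| ≤ C := by
  obtain ⟨C, hC⟩ := isCompact_Icc.exists_bound_of_continuousOn (s := Set.Icc (0:ℝ) 1)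
    (f := fun x => P.eval x) (by fun_prop)
  refine ⟨C, (norm_nonneg _).trans (hC 0 (by simp)), fun x hx => hC x ⟨hx.1.le, hx.2.le⟩⟩

lemma mono_int (r s : ℕ) : Integrable (fun p : ℝ × ℝ × ℝ => p.1 ^ r * p.2.1 ^ s *
      (1 / (1 - (1 - p.1 * p.2.1) * p.2.2))) nuC := by
  apply dom_int (fun p : ℝ × ℝ × ℝ => p.1 ^ r * p.2.1 ^ s) (by fun_prop) 1
  intro x hx y hy z hz
  have h1 := pow_le_one₀ hx.1.le hx.2.le (n := r)
  have h2 := pow_le_one₀ hy.1.le hy.2.le (n := s)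
  have h3 := pow_pos hx.1 r
  have h4 := pow_pos hy.1 s
  simp only
  rw [abs_of_pos (by positivity)]
  nlinarith

lemma poly_mem (P : Polynomial ℚ) :
    ∫ p, (Polynomial.aeval p.1 P * Polynomial.aeval p.2.1 P) *
      (1 / (1 - (1 - p.1 * p.2.1) * p.2.2)) ∂nuC ∈ spanZ := by
  have h : ∀ p : ℝ × ℝ × ℝ, (Polynomial.aeval p.1 P * Polynomial.aeval p.2.1 P) *
      (1 / (1 - (1 - p.1 * p.2.1) * p.2.2)) =
      ∑ i ∈ Finset.range (P.natDegree + 1), ∑ j ∈ Finset.range (P.natDegree + 1),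
        ((P.coeff i * P.coeff j : ℚ) : ℝ) * (p.1 ^ i * p.2.1 ^ j *
      (1 / (1 - (1 - p.1 * p.2.1) * p.2.2))) := by
    intro p
    rw [Polynomial.aeval_eq_sum_range, Polynomial.aeval_eq_sum_range, Finset.sum_mul_sum,
      Finset.sum_mul]
    refine Finset.sum_congr rfl fun i _ => ?_
    rw [Finset.sum_mul]
    refine Finset.sum_congr rfl fun j _ => ?_
    rw [Rat.smul_def, Rat.smul_def]
    push_cast
    ring
  simp_rw [h]
  rw [integral_finsetSum _ (fun i _ => integrable_finsetSum _ fun j _ =>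
    (mono_int i j).const_mul _)]
  refine spanZ.sum_mem fun i _ => ?_
  rw [integral_finsetSum _ (fun j _ => (mono_int i j).const_mul _)]
  refine spanZ.sum_mem fun j _ => ?_
  rw [integral_const_mul, ← Rat.smul_def]
  exact spanZ.smul_mem _ (mono_mem i j)

lemma ratio_bdd {x y z : ℝ} (hx : x ∈ Set.Ioo (0:ℝ) 1) (hy : y ∈ Set.Ioo (0:ℝ) 1)
    (hz : z ∈ Set.Ioo (0:ℝ) 1) (N : ℕ) :
    |(x * y * z / (1 - (1 - x * y) * z)) ^ N| ≤ 1 := by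
  obtain ⟨h1, -, -, h2⟩ := den_bounds hx hy hz
  have h3 : 0 ≤ x * y * z / (1 - (1 - x * y) * z) :=
    div_nonneg (mul_pos (mul_pos hx.1 hy.1) hz.1).le h1.le
  rw [abs_of_nonneg (pow_nonneg h3 N)]
  exact pow_le_one₀ h3 ((div_le_one h1).mpr h2)

lemma abs_one_sub_pow {x : ℝ} (hx : x ∈ Set.Ioo (0:ℝ) 1) (N : ℕ) : |(1 - x) ^ N| ≤ 1 := by
  have h : 0 ≤ 1 - x := by linarith [hx.2]
  rw [abs_of_nonneg (pow_nonneg h N)]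
  exact pow_le_one₀ h (by linarith [hx.1])

lemma parts_spec (N : ℕ) (a b : ℝ) (ha : 0 < a) (hb : 0 < b) :
    ∫ x in (0:ℝ)..1, ((Polynomial.derivative)^[N]
        ((Polynomial.X * (1 - Polynomial.X)) ^ N : Polynomial ℝ)).eval x / (a + b * x) =
      (N.factorial : ℝ) * b ^ N *
        ∫ x in (0:ℝ)..1, (x * (1 - x)) ^ N / (a + b * x) ^ (N + 1) := by
  have h := parts_many N _ dvd_rfl a b ha hb 0
  simpa using h

lemma main_int (N : ℕ) : Integrable (fun p : ℝ × ℝ × ℝ =>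
    (p.1 * p.2.1 * p.2.2 * (1 - p.1) * (1 - p.2.1) * (1 - p.2.2) /
      (1 - (1 - p.1 * p.2.1) * p.2.2)) ^ N * (1 / (1 - (1 - p.1 * p.2.1) * p.2.2))) nuC := by
  apply dom_int (fun p : ℝ × ℝ × ℝ =>
    (p.1 * p.2.1 * p.2.2 * (1 - p.1) * (1 - p.2.1) * (1 - p.2.2) /
      (1 - (1 - p.1 * p.2.1) * p.2.2)) ^ N) (by fun_prop) 1
  intro x hx y hy z hz
  have h : (x * y * z * (1 - x) * (1 - y) * (1 - z) / (1 - (1 - x * y) * z)) ^ N =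
      (x * y * z / (1 - (1 - x * y) * z)) ^ N * (1 - x) ^ N * (1 - y) ^ N * (1 - z) ^ N := by
    rw [← mul_pow, ← mul_pow, ← mul_pow]; congr 1; ring
  simp only
  rw [h, abs_mul, abs_mul, abs_mul]
  exact mul_le_one₀ (mul_le_one₀ (mul_le_one₀ (ratio_bdd hx hy hz N) (abs_nonneg _)
    (abs_one_sub_pow hx N)) (abs_nonneg _) (abs_one_sub_pow hy N)) (abs_nonneg _)
    (abs_one_sub_pow hz N)

lemma main_eq (N : ℕ) (P : Polynomial ℝ)
    (hP : P = (Polynomial.derivative)^[N] ((Polynomial.X * (1 - Polynomial.X)) ^ N : Polynomial ℝ)) :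
    ∫ p : ℝ × ℝ × ℝ, (P.eval p.1 * P.eval p.2.1) * (1 / (1 - (1 - p.1 * p.2.1) * p.2.2)) ∂nuC =
    (N.factorial : ℝ) ^ 2 * ∫ p : ℝ × ℝ × ℝ,
    (p.1 * p.2.1 * p.2.2 * (1 - p.1) * (1 - p.2.1) * (1 - p.2.2) /
      (1 - (1 - p.1 * p.2.1) * p.2.2)) ^ N * (1 / (1 - (1 - p.1 * p.2.1) * p.2.2)) ∂nuC := by
  obtain ⟨C, hC0, hC⟩ := poly_bdd P
  have hPm : Measurable (fun x => P.eval x) := P.continuous.measurable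
  have i1 : Integrable (fun p : ℝ × ℝ × ℝ => (P.eval p.1 * P.eval p.2.1) *
      (1 / (1 - (1 - p.1 * p.2.1) * p.2.2))) nuC := by
    apply dom_int (fun p : ℝ × ℝ × ℝ => P.eval p.1 * P.eval p.2.1)
      ((hPm.comp measurable_fst).mul (hPm.comp (measurable_fst.comp measurable_snd))) (C * C)
    intro x hx y hy z hz
    simp only
    rw [abs_mul]
    exact mul_le_mul (hC x hx) (hC y hy) (abs_nonneg _) hC0
  have i2 : Integrable (fun p : ℝ × ℝ × ℝ => ((p.1 * p.2.1 * p.2.2 /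
      (1 - (1 - p.1 * p.2.1) * p.2.2)) ^ N * (1 - p.1) ^ N * P.eval p.2.1) *
      (1 / (1 - (1 - p.1 * p.2.1) * p.2.2))) nuC := by
    apply dom_int (fun p : ℝ × ℝ × ℝ => ((p.1 * p.2.1 * p.2.2 /
      (1 - (1 - p.1 * p.2.1) * p.2.2)) ^ N * (1 - p.1) ^ N * P.eval p.2.1))
      (Measurable.mul (by fun_prop) (hPm.comp (measurable_fst.comp measurable_snd))) (1 * C)
    intro x hx y hy z hz
    simp only
    rw [abs_mul, abs_mul]
    exact mul_le_mul (mul_le_one₀ (ratio_bdd hx hy hz N) (abs_nonneg _)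
      (abs_one_sub_pow hx N)) (hC y hy) (abs_nonneg _) zero_le_one
  have i3 : Integrable (fun p : ℝ × ℝ × ℝ => ((1 - p.2.2) ^ N * (1 - p.1) ^ N * P.eval p.2.1) *
      (1 / (1 - (1 - p.1 * p.2.1) * p.2.2))) nuC := by
    apply dom_int (fun p : ℝ × ℝ × ℝ => ((1 - p.2.2) ^ N * (1 - p.1) ^ N * P.eval p.2.1))
      (Measurable.mul (by fun_prop) (hPm.comp (measurable_fst.comp measurable_snd))) (1 * C)
    intro x hx y hy z hz
    simp only
    rw [abs_mul, abs_mul]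
    exact mul_le_mul (mul_le_one₀ (abs_one_sub_pow hz N) (abs_nonneg _)
      (abs_one_sub_pow hx N)) (hC y hy) (abs_nonneg _) zero_le_one
  have e1 := lem_X i1 (i2.const_mul (N.factorial : ℝ)) (by
    intro y hy z hz
    simp only
    have h := parts_spec N (1 - z) (y * z) (by linarith [hz.2]) (mul_pos hy.1 hz.1)
    rw [← hP] at h
    calc _ = P.eval y * ∫ x in (0:ℝ)..1, P.eval x / (1 - z + y * z * x) := by
          rw [← intervalIntegral.integral_const_mul]
          refine intervalIntegral.integral_congr fun x _ => ?_
          rw [show 1 - (1 - x * y) * z = 1 - z + y * z * x by ring]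
          ring
      _ = _ := by
          rw [h, intervalIntegral.integral_const_mul, mul_comm (P.eval y), mul_assoc, mul_assoc]
          congr 1
          rw [mul_comm _ (P.eval y), ← mul_assoc, ← intervalIntegral.integral_const_mul]
          refine intervalIntegral.integral_congr fun x _ => ?_
          rw [show 1 - (1 - x * y) * z = 1 - z + y * z * x by ring]
          simp only [div_pow, mul_pow]
          generalize 1 - z + _ * z * _ = D
          ring)
  have e2 := lem_Z i2 i3 (by
    intro x hx y hy
    simp only
    have h0 : 0 < x * y := mul_pos hx.1 hy.1
    have h1 : x * y < 1 := by nlinarith [hx.1, hx.2, hy.1, hy.2]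
    have h := subst_z N (x * y) h0 h1
    calc _ = ((1 - x) ^ N * P.eval y) *
          ∫ z in (0:ℝ)..1, (x * y) ^ N * z ^ N / (1 - (1 - x * y) * z) ^ (N + 1) := by
          rw [← intervalIntegral.integral_const_mul]
          refine intervalIntegral.integral_congr fun z _ => ?_
          simp only [div_pow, mul_pow]
          generalize 1 - (1 - x * y) * z = D
          ring
      _ = _ := by
          rw [h, ← intervalIntegral.integral_const_mul]
          refine intervalIntegral.integral_congr fun z _ => ?_
          ring)
  have e3 := lem_Y i3 ((main_int N).const_mul (N.factorial : ℝ)) (by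
    intro x hx z hz
    simp only
    have h := parts_spec N (1 - z) (x * z) (by linarith [hz.2]) (mul_pos hx.1 hz.1)
    rw [← hP] at h
    calc _ = ((1 - z) ^ N * (1 - x) ^ N) *
            ∫ y in (0:ℝ)..1, P.eval y / (1 - z + x * z * y) := by
          rw [← intervalIntegral.integral_const_mul]
          refine intervalIntegral.integral_congr fun y _ => ?_
          rw [show 1 - (1 - x * y) * z = 1 - z + x * z * y by ring]
          ring
      _ = _ := by
          rw [h, intervalIntegral.integral_const_mul, ← mul_assoc, ← mul_assoc,
            mul_comm ((1 - z) ^ N * (1 - x) ^ N), mul_assoc, mul_assoc]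
          congr 1
          rw [← mul_assoc, ← intervalIntegral.integral_const_mul]
          refine intervalIntegral.integral_congr fun y _ => ?_
          rw [show 1 - (1 - x * y) * z = 1 - z + x * z * y by ring]
          simp only [div_pow, mul_pow]
          generalize 1 - z + _ * z * _ = D
          ring)
  rw [e1, integral_const_mul, e2, e3, integral_const_mul]
  ring

/-- The basic cellular integrals for `n = 6`, `σ = (1,3,6,4,2,5)`: for every `N ≥ 0`,
`∫₀¹∫₀¹∫₀¹ (xyz(1-x)(1-y)(1-z)/(1-(1-xy)z))^N · (1/(1-(1-xy)z)) dx dy dz` converges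
absolutely and is a ℚ-linear form `a_N + b_N ζ(3)` (Apéry's linear forms for ζ(3)). -/
theorem stmt16 (N : ℕ) :
    ∃ aN bN : ℚ,
      IntegrableOn (fun p : ℝ × ℝ × ℝ =>
          (p.1 * p.2.1 * p.2.2 * (1 - p.1) * (1 - p.2.1) * (1 - p.2.2) /
              (1 - (1 - p.1 * p.2.1) * p.2.2)) ^ N *
            (1 / (1 - (1 - p.1 * p.2.1) * p.2.2)))
        (Set.Ioo (0:ℝ) 1 ×ˢ Set.Ioo (0:ℝ) 1 ×ˢ Set.Ioo (0:ℝ) 1) ∧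
      (∫ p in Set.Ioo (0:ℝ) 1 ×ˢ Set.Ioo (0:ℝ) 1 ×ˢ Set.Ioo (0:ℝ) 1,
          (p.1 * p.2.1 * p.2.2 * (1 - p.1) * (1 - p.2.1) * (1 - p.2.2) /
              (1 - (1 - p.1 * p.2.1) * p.2.2)) ^ N *
            (1 / (1 - (1 - p.1 * p.2.1) * p.2.2))) =
        (aN : ℝ) + (bN : ℝ) * zeta3 := by

  have hI := main_int N
  have hE := main_eq N _ rfl
  have hM := poly_mem ((Polynomial.derivative)^[N]
    ((Polynomial.X * (1 - Polynomial.X)) ^ N : Polynomial ℚ))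
  have hmap : (Polynomial.derivative)^[N] ((Polynomial.X * (1 - Polynomial.X)) ^ N : Polynomial ℝ) =
      ((Polynomial.derivative)^[N]
        ((Polynomial.X * (1 - Polynomial.X)) ^ N : Polynomial ℚ)).map (algebraMap ℚ ℝ) := by
    rw [← Polynomial.iterate_derivative_map]
    simp
  rw [hmap] at hE
  simp only [Polynomial.eval_map_algebraMap] at hE
  rw [hE] at hM
  have hM2 := spanZ.smul_mem (((N.factorial : ℚ) ^ 2)⁻¹) hM
  rw [Rat.smul_def, ← mul_assoc] at hM2
  push_cast at hM2
  rw [inv_mul_cancel₀ (by positivity), one_mul] at hM2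
  unfold spanZ at hM2
  rw [Submodule.mem_span_pair] at hM2
  obtain ⟨a, b, hab⟩ := hM2
  rw [nuC_eq] at hI hab
  refine ⟨a, b, hI, ?_⟩
  rw [← hab]
  simp [Rat.smul_def]
end

section
/- Let W₄ be the wheel graph with four spokes: vertex set {0,1,2,3,4} with hub 0, rim edges e_1 = {1,2}, e_2 = {2,3}, e_3 = {3,4}, e_4 = {4,1} and spoke edges e_5 = {1,0}, e_6 = {2,0}, e_7 = {3,0}, e_8 = {4,0}. Let U(α_1,…,α_8) = Σ_T ∏_{e_i ∉ T} α_i, the sum over all spanning trees T of W₄ of the product of the variables of the edges NOT in T (the first Symanzik polynomial of W₄). Then ∫_{(0,∞)^7} U(α_1,…,α_7,1)^{−2} dα_1⋯dα_7 = 20·ζ(5), the integral converging absolutely. -/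
open MeasureTheory

/-- The edges of the wheel with four spokes `W₄` on vertices `{0,1,2,3,4}` (hub `0`):
rim edges `e₁={1,2}, e₂={2,3}, e₃={3,4}, e₄={4,1}` and spoke edges
`e₅={1,0}, e₆={2,0}, e₇={3,0}, e₈={4,0}`. -/
def wheelEdge : Fin 8 → Sym2 (Fin 5) :=
  ![s(1, 2), s(2, 3), s(3, 4), s(4, 1), s(1, 0), s(2, 0), s(3, 0), s(4, 0)]

/-- `T` (a set of edge indices) is a spanning tree of `W₄`: the graph on `{0,…,4}` formed by
the corresponding edges is connected and acyclic. -/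
def IsSpanningTree (T : Finset (Fin 8)) : Prop :=
  (SimpleGraph.fromEdgeSet (wheelEdge '' (T : Set (Fin 8)))).IsTree

open Classical in
/-- The first Symanzik polynomial of `W₄`: `U(α) = Σ_T ∏_{e ∉ T} α_e`, the sum being over
all spanning trees `T` of `W₄`. -/
noncomputable def symanzikU (α : Fin 8 → ℝ) : ℝ :=
  ∑ T : Finset (Fin 8), if IsSpanningTree T then ∏ i ∈ Tᶜ, α i else 0

/-- `ζ(5) = Σ_{k≥1} 1/k⁵`. -/
noncomputable def zeta5 : ℝ := ∑' k : ℕ, 1 / ((k : ℝ) + 1) ^ 5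


/-- A cut criterion for connectedness of the subgraph with edge set `T`. -/
def treeCut (T : Finset (Fin 8)) : Prop :=
  ∀ S : Finset (Fin 5), 0 ∈ S →
    (∀ i ∈ T, ∀ u v, wheelEdge i = s(u, v) → u ∈ S → v ∈ S) → S = Finset.univ

lemma wheelEdge_injective : Function.Injective wheelEdge := by
  unfold wheelEdge
  decide

lemma wheelEdge_not_isDiag (i : Fin 8) : ¬ (wheelEdge i).IsDiag := by
  revert i
  unfold wheelEdge
  decide

lemma adj_iff (T : Finset (Fin 8)) (u v : Fin 5) :
    (SimpleGraph.fromEdgeSet (wheelEdge '' (T : Set (Fin 8)))).Adj u v ↔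
      ∃ i ∈ T, wheelEdge i = s(u, v) := by
  rw [SimpleGraph.fromEdgeSet_adj]
  constructor
  · rintro ⟨⟨i, hi, h⟩, -⟩
    exact ⟨i, hi, h⟩
  · rintro ⟨i, hi, h⟩
    refine ⟨⟨i, hi, h⟩, ?_⟩
    rintro rfl
    have := wheelEdge_not_isDiag i
    rw [h] at this
    simp at this

lemma connected_iff (T : Finset (Fin 8)) :
    (SimpleGraph.fromEdgeSet (wheelEdge '' (T : Set (Fin 8)))).Connected ↔ treeCut T := by
  classical
  set G := SimpleGraph.fromEdgeSet (wheelEdge '' (T : Set (Fin 8))) with hG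
  constructor
  · intro h S h0 hS
    have key : ∀ u v, G.Walk u v → u ∈ S → v ∈ S := by
      intro u v p
      induction p with
      | nil => exact id
      | cons hadj _ ih =>
        intro hu
        obtain ⟨i, hi, he⟩ := (adj_iff T _ _).1 hadj
        exact ih (hS i hi _ _ he hu)
    ext v
    simp only [Finset.mem_univ, iff_true]
    obtain ⟨p⟩ := h.preconnected 0 v
    exact key _ _ p h0
  · intro h
    have := h (Finset.univ.filter fun v => G.Reachable 0 v) (by simp) (by
      intro i hi u v he hu
      simp only [Finset.mem_filter, Finset.mem_univ, true_and] at hu ⊢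
      exact hu.trans (SimpleGraph.Adj.reachable ((adj_iff T u v).2 ⟨i, hi, he⟩)))
    have h2 : ∀ v, G.Reachable 0 v := by
      intro v
      have : v ∈ Finset.univ.filter fun v => G.Reachable 0 v := by rw [this]; simp
      simpa using this
    rw [SimpleGraph.connected_iff]
    exact ⟨fun u v => (h2 u).symm.trans (h2 v), ⟨0⟩⟩

lemma isSpanningTree_iff (T : Finset (Fin 8)) :
    IsSpanningTree T ↔ T.card = 4 ∧ treeCut T := by
  classical
  unfold IsSpanningTree
  rw [SimpleGraph.isTree_iff_connected_and_card, connected_iff, and_comm]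
  have : (SimpleGraph.fromEdgeSet (wheelEdge '' (T : Set (Fin 8)))).edgeSet
      = ((T.image wheelEdge : Finset (Sym2 (Fin 5))) : Set (Sym2 (Fin 5))) := by
    rw [SimpleGraph.edgeSet_fromEdgeSet]
    ext e
    simp only [Set.mem_sdiff, Finset.coe_image, Set.mem_image, Finset.mem_coe]
    constructor
    · exact fun h => h.1
    · rintro ⟨i, hi, rfl⟩
      exact ⟨⟨i, hi, rfl⟩, wheelEdge_not_isDiag i⟩
  rw [this]
  have h2 : Nat.card ((T.image wheelEdge : Finset (Sym2 (Fin 5))) : Set (Sym2 (Fin 5))) = T.card := by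
    rw [Nat.card_coe_set_eq, Set.ncard_coe_finset, Finset.card_image_of_injective _ wheelEdge_injective]
  rw [h2]
  simp

/-- closedness of a boolean vertex labelling (hub labelled `true`) under the edges of `T` -/
def closedB (T : Finset (Fin 8)) (b1 b2 b3 b4 : Bool) : Prop :=
  (0 ∈ T → b1 = b2) ∧ (1 ∈ T → b2 = b3) ∧ (2 ∈ T → b3 = b4) ∧ (3 ∈ T → b4 = b1) ∧
    (4 ∈ T → b1 = true) ∧ (5 ∈ T → b2 = true) ∧ (6 ∈ T → b3 = true) ∧ (7 ∈ T → b4 = true)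

instance (T : Finset (Fin 8)) (b1 b2 b3 b4 : Bool) : Decidable (closedB T b1 b2 b3 b4) := by
  unfold closedB
  infer_instance

/-- boolean version of `treeCut` -/
def cutB (T : Finset (Fin 8)) : Bool :=
  decide (∀ b1 b2 b3 b4 : Bool, closedB T b1 b2 b3 b4 → (b1 && b2 && b3 && b4) = true)

lemma treeCut_iff (T : Finset (Fin 8)) : treeCut T ↔ cutB T = true := by
  unfold cutB
  rw [decide_eq_true_iff]
  constructor
  · intro h b1 b2 b3 b4 hb
    have := h (Finset.univ.filter fun v => ![true, b1, b2, b3, b4] v = true) (by simp) (by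
      intro i hi u v he hu
      simp only [Finset.mem_filter, Finset.mem_univ, true_and] at hu ⊢
      have hs : (![true, b1, b2, b3, b4] u = ![true, b1, b2, b3, b4] v) := by
        obtain ⟨h0, h1, h2, h3, h4, h5, h6, h7⟩ := hb
        fin_cases i <;> simp [wheelEdge] at he <;> rcases he with ⟨rfl, rfl⟩ | ⟨rfl, rfl⟩ <;>
          simp_all
      rw [← hs]; exact hu)
    have h2 : ∀ v, ![true, b1, b2, b3, b4] v = true := by
      intro v
      have h3 : v ∈ Finset.univ.filter fun v => ![true, b1, b2, b3, b4] v = true := by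
        rw [this]; simp
      simpa using h3
    have e1 := h2 1
    have e2 := h2 2
    have e3 := h2 3
    have e4 := h2 4
    simp at e1 e2 e3 e4
    simp [e1, e2, e3, e4]
  · intro h S h0 hS
    have hS' : ∀ i ∈ T, ∀ u v, wheelEdge i = s(u, v) → (u ∈ S ↔ v ∈ S) := fun i hi u v he =>
      ⟨hS i hi u v he, hS i hi v u (by rw [he, Sym2.eq_swap])⟩
    have := h (decide (1 ∈ S)) (decide (2 ∈ S)) (decide (3 ∈ S)) (decide (4 ∈ S)) (by
      refine ⟨fun hi => ?_, fun hi => ?_, fun hi => ?_, fun hi => ?_, fun hi => ?_, fun hi => ?_,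
        fun hi => ?_, fun hi => ?_⟩
      · simpa using hS' 0 hi 1 2 rfl
      · simpa using hS' 1 hi 2 3 rfl
      · simpa using hS' 2 hi 3 4 rfl
      · simpa using hS' 3 hi 4 1 rfl
      · simpa using (hS' 4 hi 1 0 rfl).2 h0
      · simpa using (hS' 5 hi 2 0 rfl).2 h0
      · simpa using (hS' 6 hi 3 0 rfl).2 h0
      · simpa using (hS' 7 hi 4 0 rfl).2 h0)
    simp only [Bool.and_eq_true, decide_eq_true_eq] at this
    ext v
    simp only [Finset.mem_univ, iff_true]
    fin_cases v
    · exact h0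
    · exact this.1.1.1
    · exact this.1.1.2
    · exact this.1.2
    · exact this.2

/-- The complements of the 45 spanning trees of `W₄`. -/
def treeCompl : List (Finset (Fin 8)) :=
  [{3, 5, 6, 7}, {3, 4, 6, 7}, {3, 4, 5, 7}, {3, 4, 5, 6}, {2, 5, 6, 7}, {2, 4, 6, 7}, {2, 4, 5, 7}, {2, 4, 5, 6},
    {2, 3, 5, 6}, {2, 3, 4, 6}, {2, 3, 4, 5}, {1, 5, 6, 7}, {1, 4, 6, 7}, {1, 4, 5, 7}, {1, 4, 5, 6}, {1, 3, 5, 7},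
    {1, 3, 5, 6}, {1, 3, 4, 7}, {1, 3, 4, 6}, {1, 2, 5, 7}, {1, 2, 4, 7}, {1, 2, 4, 5}, {1, 2, 3, 5}, {1, 2, 3, 4},
    {0, 5, 6, 7}, {0, 4, 6, 7}, {0, 4, 5, 7}, {0, 4, 5, 6}, {0, 3, 6, 7}, {0, 3, 5, 7}, {0, 3, 5, 6}, {0, 2, 6, 7},
    {0, 2, 5, 7}, {0, 2, 4, 6}, {0, 2, 4, 5}, {0, 2, 3, 6}, {0, 2, 3, 5}, {0, 1, 6, 7}, {0, 1, 4, 7}, {0, 1, 4, 6},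
    {0, 1, 3, 7}, {0, 1, 3, 6}, {0, 1, 2, 7}, {0, 1, 2, 4}, {0, 1, 2, 3}]

lemma treeCompl_spec : ∀ S : Finset (Fin 8),
    (Sᶜ.card = 4 ∧ cutB Sᶜ = true) ↔ S ∈ treeCompl := by
  decide +kernel

lemma treeCompl_nodup : treeCompl.Nodup := by
  decide +kernel

lemma symanzikU_eq (α : Fin 8 → ℝ) : symanzikU α =
    α 3*α 5*α 6*α 7 + α 3*α 4*α 6*α 7 + α 3*α 4*α 5*α 7 + α 3*α 4*α 5*α 6 +
    α 2*α 5*α 6*α 7 + α 2*α 4*α 6*α 7 + α 2*α 4*α 5*α 7 + α 2*α 4*α 5*α 6 +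
    α 2*α 3*α 5*α 6 + α 2*α 3*α 4*α 6 + α 2*α 3*α 4*α 5 + α 1*α 5*α 6*α 7 +
    α 1*α 4*α 6*α 7 + α 1*α 4*α 5*α 7 + α 1*α 4*α 5*α 6 + α 1*α 3*α 5*α 7 +
    α 1*α 3*α 5*α 6 + α 1*α 3*α 4*α 7 + α 1*α 3*α 4*α 6 + α 1*α 2*α 5*α 7 +
    α 1*α 2*α 4*α 7 + α 1*α 2*α 4*α 5 + α 1*α 2*α 3*α 5 + α 1*α 2*α 3*α 4 +
    α 0*α 5*α 6*α 7 + α 0*α 4*α 6*α 7 + α 0*α 4*α 5*α 7 + α 0*α 4*α 5*α 6 +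
    α 0*α 3*α 6*α 7 + α 0*α 3*α 5*α 7 + α 0*α 3*α 5*α 6 + α 0*α 2*α 6*α 7 +
    α 0*α 2*α 5*α 7 + α 0*α 2*α 4*α 6 + α 0*α 2*α 4*α 5 + α 0*α 2*α 3*α 6 +
    α 0*α 2*α 3*α 5 + α 0*α 1*α 6*α 7 + α 0*α 1*α 4*α 7 + α 0*α 1*α 4*α 6 +
    α 0*α 1*α 3*α 7 + α 0*α 1*α 3*α 6 + α 0*α 1*α 2*α 7 + α 0*α 1*α 2*α 4 +
    α 0*α 1*α 2*α 3 := by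
  classical
  unfold symanzikU
  rw [← (Equiv.sum_comp (⟨compl, compl, compl_compl, compl_compl⟩ :
    Finset (Fin 8) ≃ Finset (Fin 8)))]
  simp only [Equiv.coe_fn_mk, compl_compl]
  rw [← Finset.sum_filter]
  have : (Finset.univ.filter fun S : Finset (Fin 8) => IsSpanningTree Sᶜ)
      = treeCompl.toFinset := by
    ext S
    rw [Finset.mem_filter, List.mem_toFinset, ← treeCompl_spec, isSpanningTree_iff, treeCut_iff]
    simp
  rw [this, List.sum_toFinset _ treeCompl_nodup]
  simp only [treeCompl, List.map_cons, List.map_nil, List.sum_cons, List.sum_nil]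
  have P : ∀ a b c d : Fin 8, a ≠ b → a ≠ c → a ≠ d → b ≠ c → b ≠ d → c ≠ d →
      ∏ i ∈ ({a, b, c, d} : Finset (Fin 8)), α i = α a * α b * α c * α d := by
    intro a b c d h1 h2 h3 h4 h5 h6
    rw [Finset.prod_insert (by simp [*]), Finset.prod_insert (by simp [*]),
      Finset.prod_insert (by simp [*]), Finset.prod_singleton]
    ring
  repeat rw [P _ _ _ _ (by decide) (by decide) (by decide) (by decide) (by decide) (by decide)]
  ring

/-- The change of variables map; coordinates are `(Z₃, Z₂, Z₄, t₁, t₂, t₃, t₄)`. -/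
noncomputable def chg (x : Fin 7 → ℝ) : Fin 7 → ℝ :=
  ![(1 - x 6) / x 6 * (x 1 - x 4), (1 - x 6) / x 6 * (x 0 - x 5), (1 - x 6) / x 6 * (x 2 - x 6),
    (1 - x 6) / x 6 * (1 - x 3),
    (1 - x 6) / x 6 * (x 3 * x 1 / (x 1 - x 3)),
    (1 - x 6) / x 6 * (x 4 * x 0 / (x 0 - x 4)),
    (1 - x 6) / x 6 * (x 5 * x 2 / (x 2 - x 5))]

/-- The domain of the new variables. -/
def dom : Set (Fin 7 → ℝ) :=
  {x | (0 < x 0 ∧ 0 < x 1 ∧ 0 < x 2) ∧ (0 < x 3 ∧ x 3 < 1 ∧ x 3 < x 1) ∧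
    (0 < x 4 ∧ x 4 < x 1 ∧ x 4 < x 0) ∧ (0 < x 5 ∧ x 5 < x 0 ∧ x 5 < x 2) ∧
    (0 < x 6 ∧ x 6 < x 2 ∧ x 6 < 1)}

/-- The Jacobian matrix of `chg`. -/
noncomputable def jac (x : Fin 7 → ℝ) : Matrix (Fin 7) (Fin 7) ℝ :=
  !![0, (1 - x 6) / x 6, 0, 0, -((1 - x 6) / x 6), 0, -(x 1 - x 4) / x 6 ^ 2;
     (1 - x 6) / x 6, 0, 0, 0, 0, -((1 - x 6) / x 6), -(x 0 - x 5) / x 6 ^ 2;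
     0, 0, (1 - x 6) / x 6, 0, 0, 0, -(x 2 - x 6) / x 6 ^ 2 - (1 - x 6) / x 6;
     0, 0, 0, -((1 - x 6) / x 6), 0, 0, -(1 - x 3) / x 6 ^ 2;
     0, -((1 - x 6) / x 6 * (x 3 / (x 1 - x 3)) ^ 2), 0, (1 - x 6) / x 6 * (x 1 / (x 1 - x 3)) ^ 2,
       0, 0, -(x 3 * x 1 / (x 1 - x 3)) / x 6 ^ 2;
     -((1 - x 6) / x 6 * (x 4 / (x 0 - x 4)) ^ 2), 0, 0, 0, (1 - x 6) / x 6 * (x 0 / (x 0 - x 4)) ^ 2,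
       0, -(x 4 * x 0 / (x 0 - x 4)) / x 6 ^ 2;
     0, 0, -((1 - x 6) / x 6 * (x 5 / (x 2 - x 5)) ^ 2), 0, 0, (1 - x 6) / x 6 * (x 2 / (x 2 - x 5)) ^ 2,
       -(x 5 * x 2 / (x 2 - x 5)) / x 6 ^ 2]

lemma hasFDerivAt_lam (x : Fin 7 → ℝ) (h : x 6 ≠ 0) :
    HasFDerivAt (fun x : Fin 7 → ℝ => (1 - x 6) / x 6)
      ((-1 / x 6 ^ 2) • (ContinuousLinearMap.proj 6 : (Fin 7 → ℝ) →L[ℝ] ℝ)) x := by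
  have hd : HasDerivAt (fun t : ℝ => (1 - t) / t) (-1 / x 6 ^ 2) (x 6) := by
    refine (((hasDerivAt_id (x 6)).const_sub 1).div (hasDerivAt_id (x 6)) h).congr_deriv ?_
    simp only [id]
    field_simp
    ring
  exact hd.comp_hasFDerivAt x (hasFDerivAt_apply (𝕜 := ℝ) (6 : Fin 7) x)

lemma hasFDerivAt_par (x : Fin 7 → ℝ) (i j : Fin 7) (h : x j - x i ≠ 0) :
    HasFDerivAt (fun x : Fin 7 → ℝ => x i * x j / (x j - x i))
      (((x j / (x j - x i)) ^ 2) • (ContinuousLinearMap.proj i : (Fin 7 → ℝ) →L[ℝ] ℝ)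
        - ((x i / (x j - x i)) ^ 2) • (ContinuousLinearMap.proj j : (Fin 7 → ℝ) →L[ℝ] ℝ)) x := by
  have hi := hasFDerivAt_apply (𝕜 := ℝ) (F' := fun _ => ℝ) i x
  have hj := hasFDerivAt_apply (𝕜 := ℝ) (F' := fun _ => ℝ) j x
  have hinv := (hasDerivAt_inv h).comp_hasFDerivAt (f := fun x : Fin 7 → ℝ => x j - x i) x
    (hj.sub hi)
  refine (((hi.mul hj).mul hinv).congr_fderiv ?_).congr_of_eventuallyEq
    (Filter.Eventually.of_forall fun y => div_eq_mul_inv _ _)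
  ext v
  simp
  field_simp
  ring

lemma hasFDerivAt_chg (x : Fin 7 → ℝ) (hx : x ∈ dom) :
    HasFDerivAt chg (LinearMap.toContinuousLinearMap (Matrix.toLin' (jac x))) x := by
  obtain ⟨⟨h0, h1, h2⟩, ⟨h3, h31, h32⟩, ⟨h4, h41, h42⟩, ⟨h5, h51, h52⟩, ⟨h6, h61, h62⟩⟩ := hx
  have p : ∀ i : Fin 7, HasFDerivAt (fun x : Fin 7 → ℝ => x i)
    (ContinuousLinearMap.proj i : (Fin 7 → ℝ) →L[ℝ] ℝ) x :=
    fun i => hasFDerivAt_apply (𝕜 := ℝ) (F' := fun _ => ℝ) i x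
  have hl := hasFDerivAt_lam x h6.ne'
  have q1 := hasFDerivAt_par x 3 1 (by linarith)
  have q2 := hasFDerivAt_par x 4 0 (by linarith)
  have q3 := hasFDerivAt_par x 5 2 (by linarith)
  rw [hasFDerivAt_pi']
  intro i
  fin_cases i
  · refine (hl.mul ((p 1).sub (p 4))).congr_fderiv ?_
    ext v
    simp [jac, dotProduct, Fin.sum_univ_succ]
    ring
  · refine (hl.mul ((p 0).sub (p 5))).congr_fderiv ?_
    ext v
    simp [jac, dotProduct, Fin.sum_univ_succ]
    ring
  · refine (hl.mul ((p 2).sub (p 6))).congr_fderiv ?_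
    ext v
    simp [jac, dotProduct, Fin.sum_univ_succ]
    ring
  · refine (hl.mul ((p 3).const_sub 1)).congr_fderiv ?_
    ext v
    simp [jac, dotProduct, Fin.sum_univ_succ]
    ring
  · refine (hl.mul q1).congr_fderiv ?_
    ext v
    simp [jac, dotProduct, Fin.sum_univ_succ]
    ring
  · refine (hl.mul q2).congr_fderiv ?_
    ext v
    simp [jac, dotProduct, Fin.sum_univ_succ]
    ring
  · refine (hl.mul q3).congr_fderiv ?_
    ext v
    simp [jac, dotProduct, Fin.sum_univ_succ]
    ring

/-- the variable `q` -/
noncomputable def qq (x : Fin 7 → ℝ) : ℝ := x 3 * x 4 * x 5 * x 6 / (x 0 * x 1 * x 2)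

set_option maxHeartbeats 10000000 in
lemma det_aux (l A1 B1 A2 B2 A3 B3 c0 c1 c2 c3 c4 c5 c6 : ℝ) :
    (!![0, l, 0, 0, -l, 0, c0;
     l, 0, 0, 0, 0, -l, c1;
     0, 0, l, 0, 0, 0, c2;
     0, 0, 0, -l, 0, 0, c3;
     0, -B1, 0, A1, 0, 0, c4;
     -B2, 0, 0, 0, A2, 0, c5;
     0, 0, -B3, 0, 0, A3, c6] : Matrix (Fin 7) (Fin 7) ℝ).det =
    l ^ 3 * (A2 * A3 * c3 * A1 + A2 * A3 * B1 * c0 + A3 * B1 * B2 * c1 + B1 * B2 * c2 * B3 +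
      l * (c4 * A2 * A3 + A3 * B1 * c5 + B1 * B2 * c6)) := by
  simp [Matrix.det_succ_row_zero, Fin.sum_univ_succ, Fin.succAbove]
  ring

lemma det_jac (x : Fin 7 → ℝ) (hx : x ∈ dom) :
    (jac x).det = -((1 - qq x ^ 2) * (chg x 4 * chg x 5 * chg x 6) ^ 2 /
      (x 3 * x 4 * x 5 * x 6) ^ 2) := by
  obtain ⟨⟨h0, h1, h2⟩, ⟨h3, h31, h32⟩, ⟨h4, h41, h42⟩, ⟨h5, h51, h52⟩, ⟨h6, h61, h62⟩⟩ := hx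
  unfold jac
  rw [det_aux]
  simp only [chg, qq, Matrix.cons_val]
  generalize x 0 = Z3 at *
  generalize x 1 = Z2 at *
  generalize x 2 = Z4 at *
  generalize x 3 = t1 at *
  generalize x 4 = t2 at *
  generalize x 5 = t3 at *
  generalize x 6 = t4 at *
  have e1 : Z2 - t1 ≠ 0 := by linarith
  have e2 : Z3 - t2 ≠ 0 := by linarith
  have e3 : Z4 - t3 ≠ 0 := by linarith
  have e4 : 1 - t4 ≠ 0 := by linarith
  field_simp
  ring

lemma U_chg (x : Fin 7 → ℝ) (hx : x ∈ dom) :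
    symanzikU (Fin.snoc (chg x) 1) = chg x 4 * chg x 5 * chg x 6 * (1 - qq x) ^ 2 / qq x := by
  obtain ⟨⟨h0, h1, h2⟩, ⟨h3, h31, h32⟩, ⟨h4, h41, h42⟩, ⟨h5, h51, h52⟩, ⟨h6, h61, h62⟩⟩ := hx
  rw [symanzikU_eq]
  have k0 : (Fin.snoc (chg x) 1 : Fin 8 → ℝ) 0 = chg x 0 := rfl
  have k1 : (Fin.snoc (chg x) 1 : Fin 8 → ℝ) 1 = chg x 1 := rfl
  have k2 : (Fin.snoc (chg x) 1 : Fin 8 → ℝ) 2 = chg x 2 := rfl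
  have k3 : (Fin.snoc (chg x) 1 : Fin 8 → ℝ) 3 = chg x 3 := rfl
  have k4 : (Fin.snoc (chg x) 1 : Fin 8 → ℝ) 4 = chg x 4 := rfl
  have k5 : (Fin.snoc (chg x) 1 : Fin 8 → ℝ) 5 = chg x 5 := rfl
  have k6 : (Fin.snoc (chg x) 1 : Fin 8 → ℝ) 6 = chg x 6 := rfl
  have k7 : (Fin.snoc (chg x) 1 : Fin 8 → ℝ) 7 = 1 := rfl
  rw [k0, k1, k2, k3, k4, k5, k6, k7]
  simp only [chg, qq, Matrix.cons_val]
  generalize x 0 = Z3 at *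
  generalize x 1 = Z2 at *
  generalize x 2 = Z4 at *
  generalize x 3 = t1 at *
  generalize x 4 = t2 at *
  generalize x 5 = t3 at *
  generalize x 6 = t4 at *
  have e1 : Z2 - t1 ≠ 0 := by linarith
  have e2 : Z3 - t2 ≠ 0 := by linarith
  have e3 : Z4 - t3 ≠ 0 := by linarith
  have e4 : 1 - t4 ≠ 0 := by linarith
  field_simp
  ring

lemma chg_pos (x : Fin 7 → ℝ) (hx : x ∈ dom) (i : Fin 7) : 0 < chg x i := by
  obtain ⟨⟨h0, h1, h2⟩, ⟨h3, h31, h32⟩, ⟨h4, h41, h42⟩, ⟨h5, h51, h52⟩, ⟨h6, h61, h62⟩⟩ := hx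
  have hl : 0 < (1 - x 6) / x 6 := div_pos (by linarith) h6
  fin_cases i
  · exact mul_pos hl (by linarith)
  · exact mul_pos hl (by linarith)
  · exact mul_pos hl (by linarith)
  · exact mul_pos hl (by linarith)
  · exact mul_pos hl (div_pos (mul_pos h3 h1) (by linarith))
  · exact mul_pos hl (div_pos (mul_pos h4 h0) (by linarith))
  · exact mul_pos hl (div_pos (mul_pos h5 h2) (by linarith))

lemma inj_step {w z w' z' d e : ℝ} (hw : 0 < w) (hwz : w < z) (hw' : 0 < w') (hwz' : w' < z')
    (h : d * (z * z') = e * (w * w')) : |d| < |e| ∨ (d = 0 ∧ e = 0) := by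
  have hz : 0 < z * z' := mul_pos (hw.trans hwz) (hw'.trans hwz')
  have hww : 0 < w * w' := mul_pos hw hw'
  have hlt : w * w' < z * z' := mul_lt_mul'' hwz hwz' hw.le hw'.le
  have h2 : |d| * (z * z') = |e| * (w * w') := by
    have := congrArg abs h
    rwa [abs_mul d, abs_mul e, abs_of_pos hz, abs_of_pos hww] at this
  by_cases he : e = 0
  · right
    subst he
    refine ⟨?_, rfl⟩
    have : d * (z * z') = 0 := by rw [h]; ring
    rcases mul_eq_zero.1 this with h | h
    · exact h
    · exact absurd h hz.ne'
  · left
    have he' : 0 < |e| := abs_pos.2 he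
    by_contra hcon
    push Not at hcon
    nlinarith

lemma par_step {l Z t l' Z' t' : ℝ} (htZ : t < Z) (htZ' : t' < Z')
    (h : l * (t * Z / (Z - t)) = l' * (t' * Z' / (Z' - t'))) :
    (l * t - l' * t') * ((l * Z) * (l' * Z')) = (l * Z - l' * Z') * ((l * t) * (l' * t')) := by
  have e1 : Z - t ≠ 0 := by linarith
  have e2 : Z' - t' ≠ 0 := by linarith
  field_simp at h
  linear_combination (l * l') * h

set_option maxHeartbeats 2000000 in
lemma chg_injOn : Set.InjOn chg dom := by
  intro x hx y hy hxy
  have c := fun i => congrFun hxy i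
  have c0 := c 0
  have c1 := c 1
  have c2 := c 2
  have c3 := c 3
  have c4 := c 4
  have c5 := c 5
  have c6 := c 6
  clear c hxy
  simp only [chg, Matrix.cons_val] at c0 c1 c2 c3 c4 c5 c6
  obtain ⟨⟨h0, h1, h2⟩, ⟨h3, h31, h32⟩, ⟨h4, h41, h42⟩, ⟨h5, h51, h52⟩, ⟨h6, h61, h62⟩⟩ := hx
  obtain ⟨⟨g0, g1, g2⟩, ⟨g3, g31, g32⟩, ⟨g4, g41, g42⟩, ⟨g5, g51, g52⟩, ⟨g6, g61, g62⟩⟩ := hy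
  have hl : 0 < (1 - x 6) / x 6 := div_pos (by linarith) h6
  have gl : 0 < (1 - y 6) / y 6 := div_pos (by linarith) g6
  have hl6 : (1 - x 6) / x 6 * x 6 = 1 - x 6 := by field_simp
  have gl6 : (1 - y 6) / y 6 * y 6 = 1 - y 6 := by field_simp
  set l := (1 - x 6) / x 6 with hldef
  set m := (1 - y 6) / y 6 with hmdef
  clear_value l m
  have s1 := par_step h32 g32 c4
  have s2 := par_step h42 g42 c5
  have s3 := par_step h52 g52 c6
  have s4 : (l * x 6 - m * y 6) * (l * m) = (l - m) * ((l * x 6) * (m * y 6)) := by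
    linear_combination (l * m * (1 - y 6)) * hl6 + (l * m * (x 6 - 1)) * gl6
  have r1 := inj_step (d := l * x 3 - m * y 3) (e := l * x 1 - m * y 1)
    (mul_pos hl h3) (mul_lt_mul_of_pos_left h32 hl)
    (mul_pos gl g3) (mul_lt_mul_of_pos_left g32 gl) s1
  have r2 := inj_step (d := l * x 4 - m * y 4) (e := l * x 0 - m * y 0)
    (mul_pos hl h4) (mul_lt_mul_of_pos_left h42 hl)
    (mul_pos gl g4) (mul_lt_mul_of_pos_left g42 gl) s2
  have r3 := inj_step (d := l * x 5 - m * y 5) (e := l * x 2 - m * y 2)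
    (mul_pos hl h5) (mul_lt_mul_of_pos_left h52 hl)
    (mul_pos gl g5) (mul_lt_mul_of_pos_left g52 gl) s3
  have r4 := inj_step (d := l * x 6 - m * y 6) (e := l - m)
    (mul_pos hl h6) (by nlinarith : l * x 6 < l)
    (mul_pos gl g6) (by nlinarith : m * y 6 < m) s4
  have d1 : l - m = l * x 3 - m * y 3 := by linarith
  have d2 : l * x 1 - m * y 1 = l * x 4 - m * y 4 := by linarith
  have d3 : l * x 0 - m * y 0 = l * x 5 - m * y 5 := by linarith
  have d4 : l * x 2 - m * y 2 = l * x 6 - m * y 6 := by linarith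
  have key : l - m = 0 ∧ l * x 1 - m * y 1 = 0 ∧ l * x 0 - m * y 0 = 0 ∧ l * x 2 - m * y 2 = 0 := by
    rw [← d1] at r1
    rw [← d2] at r2
    rw [← d3] at r3
    rw [← d4] at r4
    generalize l - m = A at *
    generalize l * x 1 - m * y 1 = B at *
    generalize l * x 0 - m * y 0 = C at *
    generalize l * x 2 - m * y 2 = D at *
    clear * - r1 r2 r3 r4
    have ab : ∀ d e : ℝ, (|d| < |e| ∨ (d = 0 ∧ e = 0)) → |d| ≤ |e| := by
      rintro d e (h | ⟨rfl, rfl⟩)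
      · exact h.le
      · exact le_rfl
    have u1 := ab _ _ r1
    have u2 := ab _ _ r2
    have u3 := ab _ _ r3
    have u4 := ab _ _ r4
    have v1 := r1.resolve_left (by intro h; linarith)
    have v2 := r2.resolve_left (by intro h; linarith)
    have v3 := r3.resolve_left (by intro h; linarith)
    exact ⟨v1.1, v1.2, v2.2, v3.2⟩
  obtain ⟨k1, k2, k3, k4⟩ := key
  have hlm : m = l := by linarith
  rw [hlm] at k2 k3 k4 d1 d2 d3 d4
  have can : ∀ a b : ℝ, l * a - l * b = 0 → a = b := fun a b h =>
    mul_left_cancel₀ hl.ne' (sub_eq_zero.1 h)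
  funext i
  fin_cases i
  · exact can _ _ k3
  · exact can _ _ k2
  · exact can _ _ k4
  · exact can (x 3) (y 3) (by linarith)
  · exact can (x 4) (y 4) (by linarith)
  · exact can (x 5) (y 5) (by linarith)
  · exact can (x 6) (y 6) (by linarith)

lemma par_rec {s z : ℝ} (hs : 0 < s) (hz : 0 < z) :
    0 < s * z / (s + z) ∧ s * z / (s + z) < z ∧ s * z / (s + z) < s ∧
      (s * z / (s + z)) * z / (z - s * z / (s + z)) = s := by
  have h : 0 < s + z := by linarith
  have e : z - s * z / (s + z) = z * z / (s + z) := by field_simp; ring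
  refine ⟨by positivity, ?_, ?_, ?_⟩
  · rw [div_lt_iff₀ h]; nlinarith
  · rw [div_lt_iff₀ h]; nlinarith
  · rw [e]; field_simp

lemma fix_exists {a1 a2 a3 a4 s1 s2 s3 : ℝ} (ha1 : 0 < a1) (ha2 : 0 < a2) (ha3 : 0 < a3)
    (ha4 : 0 < a4) (hs1 : 0 < s1) (hs2 : 0 < s2) (hs3 : 0 < s3) :
    ∃ z1 z2 z3 z4 w1 w2 w3 w4 : ℝ, 0 < z1 ∧ w4 = z1 / (1 + z1) ∧ z4 = a4 + w4 ∧
      w3 = s3 * z4 / (s3 + z4) ∧ z3 = a3 + w3 ∧ w2 = s2 * z3 / (s2 + z3) ∧ z2 = a2 + w2 ∧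
      w1 = s1 * z2 / (s1 + z2) ∧ z1 = a1 + w1 := by
  let w4 : ℝ → ℝ := fun z => z / (1 + z)
  let z4 : ℝ → ℝ := fun z => a4 + w4 z
  let w3 : ℝ → ℝ := fun z => s3 * z4 z / (s3 + z4 z)
  let z3 : ℝ → ℝ := fun z => a3 + w3 z
  let w2 : ℝ → ℝ := fun z => s2 * z3 z / (s2 + z3 z)
  let z2 : ℝ → ℝ := fun z => a2 + w2 z
  let w1 : ℝ → ℝ := fun z => s1 * z2 z / (s1 + z2 z)
  have p4 : ∀ z, 0 ≤ z → 0 < z4 z := fun z hz => by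
    have : 0 ≤ w4 z := div_nonneg hz (by linarith)
    exact add_pos_of_pos_of_nonneg ha4 this
  have p3 : ∀ z, 0 ≤ z → 0 < z3 z := fun z hz => add_pos ha3 (par_rec hs3 (p4 z hz)).1
  have p2 : ∀ z, 0 ≤ z → 0 < z2 z := fun z hz => add_pos ha2 (par_rec hs2 (p3 z hz)).1
  have p1 : ∀ z, 0 ≤ z → 0 < w1 z ∧ w1 z < s1 := fun z hz =>
    ⟨(par_rec hs1 (p2 z hz)).1, (par_rec hs1 (p2 z hz)).2.2.1⟩
  have k4 : ContinuousOn z4 (Set.Icc 0 (a1 + s1)) :=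
    continuousOn_const.add (continuousOn_id.div (continuousOn_const.add continuousOn_id)
      (fun z hz => by have := hz.1; change 1 + z ≠ 0; linarith))
  have k3 : ContinuousOn z3 (Set.Icc 0 (a1 + s1)) :=
    continuousOn_const.add ((continuousOn_const.mul k4).div (continuousOn_const.add k4)
      (fun z hz => (add_pos hs3 (p4 z hz.1)).ne'))
  have k2 : ContinuousOn z2 (Set.Icc 0 (a1 + s1)) :=
    continuousOn_const.add ((continuousOn_const.mul k3).div (continuousOn_const.add k3)
      (fun z hz => (add_pos hs2 (p3 z hz.1)).ne'))
  have k1 : ContinuousOn (fun z => a1 + w1 z - z) (Set.Icc 0 (a1 + s1)) :=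
    (continuousOn_const.add ((continuousOn_const.mul k2).div (continuousOn_const.add k2)
      (fun z hz => (add_pos hs1 (p2 z hz.1)).ne'))).sub continuousOn_id
  have hM : (0 : ℝ) ≤ a1 + s1 := by linarith
  have ivt := intermediate_value_Icc' hM k1
  have hmem : (0 : ℝ) ∈ Set.Icc (a1 + w1 (a1 + s1) - (a1 + s1)) (a1 + w1 0 - 0) := by
    have u1 := (p1 (a1 + s1) hM).2
    have u2 := (p1 0 le_rfl).1
    constructor <;> linarith
  obtain ⟨z, hz, hz0⟩ := ivt hmem
  simp only at hz0
  have hw := (p1 z hz.1).1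
  exact ⟨z, z2 z, z3 z, z4 z, w1 z, w2 z, w3 z, w4 z, by linarith, rfl, rfl, rfl, rfl, rfl, rfl,
    rfl, by linarith⟩

lemma chg_surj (α : Fin 7 → ℝ) (h : ∀ i, 0 < α i) : ∃ x ∈ dom, chg x = α := by
  obtain ⟨z1, z2, z3, z4, w1, w2, w3, w4, hz1, e4, f4, e3, f3, e2, f2, e1, f1⟩ :=
    fix_exists (h 3) (h 0) (h 1) (h 2) (h 4) (h 5) (h 6)
  have hw4 : 0 < w4 := by rw [e4]; positivity
  have hz4 : 0 < z4 := by have := h 2; linarith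
  have P3 := par_rec (h 6) hz4
  rw [← e3] at P3
  have hz3 : 0 < z3 := by have := h 1; linarith [P3.1]
  have P2 := par_rec (h 5) hz3
  rw [← e2] at P2
  have hz2 : 0 < z2 := by have := h 0; linarith [P2.1]
  have P1 := par_rec (h 4) hz2
  rw [← e1] at P1
  have hw41 : w4 / z1 < 1 := by
    rw [e4, div_div, div_lt_one (by positivity)]; nlinarith
  have hl : (1 - w4 / z1) / (w4 / z1) = z1 := by
    rw [e4]; field_simp; ring
  have resc : ∀ w z : ℝ, z1 * (w / z1 * (z / z1) / (z / z1 - w / z1)) = w * z / (z - w) := by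
    intro w z
    rw [← sub_div]
    by_cases hwz : z - w = 0
    · simp [hwz]
    · field_simp
  refine ⟨![z3 / z1, z2 / z1, z4 / z1, w1 / z1, w2 / z1, w3 / z1, w4 / z1], ?_, ?_⟩
  · have H0 := h 0
    have H1 := h 1
    have H2 := h 2
    have H3 := h 3
    have dv : ∀ a b : ℝ, a < b → a / z1 < b / z1 := fun a b hab => div_lt_div_of_pos_right hab hz1
    refine ⟨⟨div_pos hz3 hz1, div_pos hz2 hz1, div_pos hz4 hz1⟩,
      ⟨div_pos P1.1 hz1, ?_, dv _ _ P1.2.1⟩, ⟨div_pos P2.1 hz1, dv _ _ ?_, dv _ _ P2.2.1⟩,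
      ⟨div_pos P3.1 hz1, dv _ _ ?_, dv _ _ P3.2.1⟩, ⟨div_pos hw4 hz1, dv _ _ ?_, hw41⟩⟩
    · change w1 / z1 < 1
      rw [div_lt_one hz1]; linarith
    all_goals linarith
  · funext i
    have cc : ∀ a : ℝ, z1 * (a / z1) = a := fun a => by field_simp
    fin_cases i <;> simp only [chg, Matrix.cons_val, Fin.zero_eta, Fin.mk_one, Fin.reduceFinMk] <;> rw [hl]
    · rw [mul_sub, cc, cc]; linarith
    · rw [mul_sub, cc, cc]; linarith
    · rw [mul_sub, cc, cc]; linarith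
    · rw [mul_sub, cc]; linarith
    · rw [resc]; exact P1.2.2.2
    · rw [resc]; exact P2.2.2.2
    · rw [resc]; exact P3.2.2.2

lemma chg_image : chg '' dom = {α : Fin 7 → ℝ | ∀ i, 0 < α i} := by
  ext α
  constructor
  · rintro ⟨x, hx, rfl⟩
    exact chg_pos x hx
  · intro h
    obtain ⟨x, hx, he⟩ := chg_surj α h
    exact ⟨x, hx, he⟩

lemma measurableSet_dom : MeasurableSet dom := by
  have m : ∀ i : Fin 7, Measurable fun x : Fin 7 → ℝ => x i := fun i => measurable_pi_apply i
  have lt : ∀ f g : (Fin 7 → ℝ) → ℝ, Measurable f → Measurable g →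
      MeasurableSet {x | f x < g x} := fun f g hf hg => measurableSet_lt hf hg
  have c0 : Measurable fun _ : Fin 7 → ℝ => (0 : ℝ) := measurable_const
  have c1 : Measurable fun _ : Fin 7 → ℝ => (1 : ℝ) := measurable_const
  exact ((lt _ _ c0 (m 0)).inter ((lt _ _ c0 (m 1)).inter (lt _ _ c0 (m 2)))).inter
    (((lt _ _ c0 (m 3)).inter ((lt _ _ (m 3) c1).inter (lt _ _ (m 3) (m 1)))).inter
    (((lt _ _ c0 (m 4)).inter ((lt _ _ (m 4) (m 1)).inter (lt _ _ (m 4) (m 0)))).inter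
    (((lt _ _ c0 (m 5)).inter ((lt _ _ (m 5) (m 0)).inter (lt _ _ (m 5) (m 2)))).inter
    ((lt _ _ c0 (m 6)).inter ((lt _ _ (m 6) (m 2)).inter (lt _ _ (m 6) c1))))))

lemma qq_pos (x : Fin 7 → ℝ) (hx : x ∈ dom) : 0 < qq x := by
  obtain ⟨⟨h0, h1, h2⟩, ⟨h3, h31, h32⟩, ⟨h4, h41, h42⟩, ⟨h5, h51, h52⟩, ⟨h6, h61, h62⟩⟩ := hx
  unfold qq
  positivity

lemma qq_lt_one (x : Fin 7 → ℝ) (hx : x ∈ dom) : qq x < 1 := by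
  obtain ⟨⟨h0, h1, h2⟩, ⟨h3, h31, h32⟩, ⟨h4, h41, h42⟩, ⟨h5, h51, h52⟩, ⟨h6, h61, h62⟩⟩ := hx
  unfold qq
  rw [div_lt_one (by positivity)]
  have a1 : x 3 * x 4 < 1 * x 1 := mul_lt_mul'' h31 h41 h3.le h4.le
  have a2 : x 3 * x 4 * x 5 < 1 * x 1 * x 0 := mul_lt_mul'' a1 h51 (by positivity) h5.le
  have a3 : x 3 * x 4 * x 5 * x 6 < 1 * x 1 * x 0 * x 2 :=
    mul_lt_mul'' a2 h61 (by positivity) h6.le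
  linarith

lemma hasSum_sq {q : ℝ} (h0 : 0 < q) (h1 : q < 1) :
    HasSum (fun n : ℕ => ((n : ℝ) + 1) ^ 2 * q ^ n) ((1 + q) / (1 - q) ^ 3) := by
  have hq : ‖q‖ < 1 := by rwa [Real.norm_of_nonneg h0.le]
  have s2 := (hasSum_choose_mul_geometric_of_norm_lt_one 2 hq).mul_left 2
  have s1 := hasSum_choose_mul_geometric_of_norm_lt_one 1 hq
  have e : (1 + q) / (1 - q) ^ 3 = 2 * (1 / (1 - q) ^ (2 + 1)) - 1 / (1 - q) ^ (1 + 1) := by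
    have : 1 - q ≠ 0 := by linarith
    field_simp
    ring
  rw [e]
  refine (s2.sub s1).congr_fun ?_
  intro n
  rw [Nat.cast_choose_two]
  push_cast
  simp
  ring

lemma integrand_eq (x : Fin 7 → ℝ) (hx : x ∈ dom) :
    |(jac x).det| * (symanzikU (Fin.snoc (chg x) 1) ^ 2)⁻¹ =
      qq x ^ 2 * ((1 + qq x) / (1 - qq x) ^ 3) / (x 3 * x 4 * x 5 * x 6) ^ 2 := by
  have hq0 := qq_pos x hx
  have hq1 := qq_lt_one x hx
  have h4 := chg_pos x hx 4
  have h5 := chg_pos x hx 5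
  have h6 := chg_pos x hx 6
  rw [det_jac x hx, U_chg x hx, abs_neg, abs_of_nonneg]
  · obtain ⟨-, ⟨k3, -⟩, ⟨k4, -⟩, ⟨k5, -⟩, ⟨k6, -⟩⟩ := hx
    have : 1 - qq x ≠ 0 := by linarith
    field_simp
    ring
  · have : 0 ≤ 1 - qq x ^ 2 := by nlinarith
    positivity

lemma lintegral_cov :
    ∫⁻ α in {α : Fin 7 → ℝ | ∀ i, 0 < α i}, ENNReal.ofReal ((symanzikU (Fin.snoc α 1) ^ 2)⁻¹) =
      ∑' n : ℕ, ENNReal.ofReal (((n : ℝ) + 1) ^ 2) * ∫⁻ x in dom,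
        ENNReal.ofReal ((x 3 * x 4 * x 5 * x 6) ^ n / (x 0 * x 1 * x 2) ^ (n + 2)) := by
  rw [← chg_image, lintegral_image_eq_lintegral_abs_det_fderiv_mul volume measurableSet_dom
    (fun x hx => (hasFDerivAt_chg x hx).hasFDerivWithinAt) chg_injOn]
  have e1 : ∀ x ∈ dom, ENNReal.ofReal
      |(LinearMap.toContinuousLinearMap (Matrix.toLin' (jac x))).det| *
        ENNReal.ofReal ((symanzikU (Fin.snoc (chg x) 1) ^ 2)⁻¹) =
      ∑' n : ℕ, ENNReal.ofReal (((n : ℝ) + 1) ^ 2) *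
        ENNReal.ofReal ((x 3 * x 4 * x 5 * x 6) ^ n / (x 0 * x 1 * x 2) ^ (n + 2)) := by
    intro x hx
    have hdet : (LinearMap.toContinuousLinearMap (Matrix.toLin' (jac x))).det = (jac x).det := by
      simp [ContinuousLinearMap.det]
    rw [hdet, ← ENNReal.ofReal_mul (abs_nonneg _), integrand_eq x hx]
    have hs := ((hasSum_sq (qq_pos x hx) (qq_lt_one x hx)).mul_left (qq x ^ 2)).div_const
      ((x 3 * x 4 * x 5 * x 6) ^ 2)
    have hq0 := qq_pos x hx
    rw [← hs.tsum_eq, ENNReal.ofReal_tsum_of_nonneg (fun n => by positivity) hs.summable]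
    refine tsum_congr fun n => ?_
    rw [← ENNReal.ofReal_mul (by positivity)]
    congr 1
    obtain ⟨⟨h0, h1, h2⟩, ⟨h3, -⟩, ⟨h4, -⟩, ⟨h5, -⟩, ⟨h6, -⟩⟩ := hx
    have hT : x 3 * x 4 * x 5 * x 6 ≠ 0 := by positivity
    have hZ : x 0 * x 1 * x 2 ≠ 0 := by positivity
    unfold qq
    generalize x 3 * x 4 * x 5 * x 6 = T at *
    generalize x 0 * x 1 * x 2 = Z at *
    rw [div_pow, div_pow]
    field_simp
    ring
  rw [setLIntegral_congr_fun measurableSet_dom e1]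
  rw [lintegral_tsum]
  · refine tsum_congr fun n => ?_
    rw [lintegral_const_mul' _ _ ENNReal.ofReal_ne_top]
  · intro n
    refine Measurable.aemeasurable ?_
    fun_prop

lemma lintegral_cons {n : ℕ} (f : (Fin (n + 1) → ℝ) → ENNReal) (hf : Measurable f) :
    ∫⁻ x, f x = ∫⁻ a : ℝ, ∫⁻ v : Fin n → ℝ, f (Fin.cons a v) := by
  have h := (volume_preserving_piFinSuccAbove (fun _ : Fin (n + 1) => ℝ) 0).symm
  rw [← h.lintegral_comp_emb (MeasurableEquiv.measurableEmbedding _)]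
  have e : ∀ p : ℝ × (Fin n → ℝ),
      (MeasurableEquiv.piFinSuccAbove (fun _ : Fin (n + 1) => ℝ) 0).symm p = Fin.cons p.1 p.2 := by
    intro p
    rw [MeasurableEquiv.piFinSuccAbove_symm_apply, Fin.insertNthEquiv_zero]
    rfl
  have hm := (hf.comp (MeasurableEquiv.piFinSuccAbove (fun _ : Fin (n + 1) => ℝ) 0).symm.measurable)
  have := lintegral_prod (μ := volume) (ν := volume) _ hm.aemeasurable
  rw [← Measure.volume_eq_prod] at this
  simp only [Function.comp_def, e] at this
  simpa only [e] using this

lemma measurable_cons {n : ℕ} (a : ℝ) :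
    Measurable fun v : Fin n → ℝ => (Fin.cons a v : Fin (n + 1) → ℝ) := by
  rw [measurable_pi_iff]
  intro i
  refine Fin.cases ?_ (fun j => ?_) i
  · simp
  · simpa using measurable_pi_apply j

lemma lintegral_seven (f : (Fin 7 → ℝ) → ENNReal) (hf : Measurable f) :
    ∫⁻ x, f x = ∫⁻ a : ℝ, ∫⁻ b : ℝ, ∫⁻ c : ℝ, ∫⁻ d : ℝ, ∫⁻ e : ℝ, ∫⁻ g : ℝ, ∫⁻ h : ℝ,
      f ![a, b, c, d, e, g, h] := by
  rw [lintegral_cons f hf]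
  refine lintegral_congr fun a => ?_
  have hf1 := hf.comp (measurable_cons a)
  refine (lintegral_cons _ hf1).trans ?_
  refine lintegral_congr fun b => ?_
  have hf2 := hf1.comp (measurable_cons b)
  refine (lintegral_cons _ hf2).trans ?_
  refine lintegral_congr fun c => ?_
  have hf3 := hf2.comp (measurable_cons c)
  refine (lintegral_cons _ hf3).trans ?_
  refine lintegral_congr fun d => ?_
  have hf4 := hf3.comp (measurable_cons d)
  refine (lintegral_cons _ hf4).trans ?_
  refine lintegral_congr fun e => ?_
  have hf5 := hf4.comp (measurable_cons e)
  refine (lintegral_cons _ hf5).trans ?_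
  refine lintegral_congr fun g => ?_
  have hf6 := hf5.comp (measurable_cons g)
  refine (lintegral_cons _ hf6).trans ?_
  refine lintegral_congr fun h => ?_
  rw [lintegral_unique]
  simp only [volume_pi, Measure.pi_univ, Finset.univ_eq_empty, Finset.prod_empty, mul_one,
    Function.comp_def]
  congr 1

lemma lint_pow (n : ℕ) {m : ℝ} (hm : 0 ≤ m) :
    ∫⁻ t in Set.Ioc 0 m, ENNReal.ofReal (t ^ n) = ENNReal.ofReal (m ^ (n + 1) / (n + 1)) := by
  rw [← ofReal_integral_eq_lintegral_ofReal]
  · rw [← intervalIntegral.integral_of_le hm, integral_pow]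
    simp
  · exact (continuous_pow n).integrableOn_Ioc
  · refine (ae_restrict_iff' measurableSet_Ioc).2 (.of_forall fun t ht => ?_)
    exact pow_nonneg ht.1.le n

lemma lint_inv {m L c : ℝ} (hm : 0 < m) (hL : m ≤ L) (hc : 0 ≤ c) :
    ∫⁻ t in Set.Ioc m L, ENNReal.ofReal (c * t⁻¹) = ENNReal.ofReal (c * Real.log (L / m)) := by
  rw [← ofReal_integral_eq_lintegral_ofReal]
  · rw [← intervalIntegral.integral_of_le hL, intervalIntegral.integral_const_mul,
      integral_inv_of_pos hm (hm.trans_le hL)]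
  · refine IntegrableOn.mono_set (t := Set.Icc m L) ?_ Set.Ioc_subset_Icc_self
    refine ContinuousOn.integrableOn_Icc ?_
    refine continuousOn_const.mul (continuousOn_id.inv₀ fun t ht => ?_)
    exact (hm.trans_le ht.1).ne'
  · refine (ae_restrict_iff' measurableSet_Ioc).2 (.of_forall fun t ht => ?_)
    exact mul_nonneg hc (inv_nonneg.2 (hm.trans ht.1).le)

lemma lint_ftc {g g' : ℝ → ℝ} {a l : ℝ} (h1 : ∀ x ∈ Set.Ici a, HasDerivAt g (g' x) x)
    (h2 : ∀ x ∈ Set.Ioi a, 0 ≤ g' x) (h3 : Filter.Tendsto g Filter.atTop (nhds l)) :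
    ∫⁻ t in Set.Ioi a, ENNReal.ofReal (g' t) = ENNReal.ofReal (l - g a) := by
  rw [← ofReal_integral_eq_lintegral_ofReal]
  · rw [integral_Ioi_of_hasDerivAt_of_nonneg' h1 h2 h3]
  · exact integrableOn_Ioi_deriv_of_nonneg' h1 h2 h3
  · exact (ae_restrict_iff' measurableSet_Ioi).2 (.of_forall h2)

lemma tendsto_inv_pow (n : ℕ) :
    Filter.Tendsto (fun x : ℝ => (x ^ (n + 1))⁻¹) Filter.atTop (nhds 0) :=
  (Filter.tendsto_pow_atTop (by omega)).inv_tendsto_atTop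

lemma hasDerivAt_inv_pow (n : ℕ) {x : ℝ} (hx : 0 < x) :
    HasDerivAt (fun x : ℝ => (x ^ (n + 1))⁻¹) (-((n + 1) * (x ^ (n + 2))⁻¹)) x := by
  refine ((hasDerivAt_pow (n + 1) x).inv (pow_pos hx _).ne').congr_deriv ?_
  simp only [Nat.add_sub_cancel]
  push_cast
  field_simp
  ring

lemma lint_tail (n : ℕ) {L c : ℝ} (hL : 0 < L) (hc : 0 ≤ c) :
    ∫⁻ t in Set.Ioi L, ENNReal.ofReal (c * (t ^ (n + 2))⁻¹) =
      ENNReal.ofReal (c / ((n + 1) * L ^ (n + 1))) := by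
  have h := lint_ftc (g := fun t => -(c / (n + 1)) * (t ^ (n + 1))⁻¹)
    (g' := fun t => c * (t ^ (n + 2))⁻¹) (a := L) (l := 0) ?_ ?_ ?_
  · rw [h]
    congr 1
    field_simp
    ring
  · intro x hx
    refine ((hasDerivAt_inv_pow n (hL.trans_le hx)).const_mul _).congr_deriv ?_
    field_simp
  · intro x hx
    have : 0 < x := hL.trans hx
    positivity
  · simpa using (tendsto_inv_pow n).const_mul (-(c / (n + 1)))

lemma tendsto_log_pow (n k : ℕ) :
    Filter.Tendsto (fun x : ℝ => Real.log x ^ k * (x ^ (n + 1))⁻¹) Filter.atTop (nhds 0) := by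
  have h := (Real.isLittleO_pow_log_id_atTop (n := k)).tendsto_div_nhds_zero
  simp only [id] at h
  have h' := h.abs
  rw [abs_zero] at h'
  refine squeeze_zero_norm' ?_ h'
  filter_upwards [Filter.eventually_ge_atTop 1] with x hx
  have hx0 : 0 < x := by linarith
  rw [Real.norm_eq_abs, div_eq_mul_inv, abs_mul, abs_mul]
  refine mul_le_mul_of_nonneg_left ?_ (abs_nonneg _)
  rw [abs_of_pos (by positivity), abs_of_pos (by positivity)]
  refine inv_anti₀ hx0 ?_
  exact le_self_pow₀ hx (by omega)

/-- the final one-dimensional integral on `(1, ∞)` -/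
lemma lint_final_tail (n : ℕ) :
    ∫⁻ t in Set.Ioi (1 : ℝ), ENNReal.ofReal ((t ^ (n + 2))⁻¹ * (2 / (n + 1) + Real.log t) ^ 2) =
      ENNReal.ofReal (10 / ((n : ℝ) + 1) ^ 3) := by
  have hN : (0 : ℝ) < n + 1 := by positivity
  have h := lint_ftc
    (g := fun t => -((t ^ (n + 1))⁻¹ * (10 / ((n : ℝ) + 1) ^ 3 + 6 / ((n : ℝ) + 1) ^ 2 * Real.log t
      + 1 / ((n : ℝ) + 1) * Real.log t ^ 2)))
    (g' := fun t => (t ^ (n + 2))⁻¹ * (2 / (n + 1) + Real.log t) ^ 2) (a := 1) (l := 0) ?_ ?_ ?_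
  · rw [h]
    congr 1
    simp
  · intro x hx
    have hx0 : (0 : ℝ) < x := lt_of_lt_of_le one_pos hx
    have hl := Real.hasDerivAt_log hx0.ne'
    refine (((hasDerivAt_inv_pow n hx0).mul (((hl.const_mul (6 / ((n : ℝ) + 1) ^ 2)).const_add
      (10 / ((n : ℝ) + 1) ^ 3)).add ((hl.pow 2).const_mul (1 / ((n : ℝ) + 1))))).neg).congr_deriv ?_
    simp only [Nat.cast_ofNat, Nat.add_one_sub_one, pow_one, Pi.add_apply, Pi.pow_apply]
    have e : (x ^ (n + 1))⁻¹ = x * (x ^ (n + 2))⁻¹ := by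
      field_simp
      ring
    rw [e]
    field_simp
    ring
  · intro x hx
    have : (0 : ℝ) < x := lt_trans one_pos hx
    positivity
  · have h0 := (tendsto_inv_pow n).const_mul (10 / ((n : ℝ) + 1) ^ 3)
    have h1 := (tendsto_log_pow n 1).const_mul (6 / ((n : ℝ) + 1) ^ 2)
    have h2 := (tendsto_log_pow n 2).const_mul (1 / ((n : ℝ) + 1))
    have h3 := ((h0.add h1).add h2).neg
    simp only [mul_zero, add_zero, neg_zero] at h3
    refine h3.congr fun x => ?_
    ring

lemma lint_final_head (n : ℕ) :
    ∫⁻ t in Set.Ioo (0 : ℝ) 1, ENNReal.ofReal (t ^ n * (2 / (n + 1) - Real.log t) ^ 2) =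
      ENNReal.ofReal (10 / ((n : ℝ) + 1) ^ 3) := by
  rw [← lint_final_tail]
  have him : (fun x : ℝ => x⁻¹) '' Set.Ioi 1 = Set.Ioo 0 1 := by
    ext y
    constructor
    · rintro ⟨x, hx, rfl⟩
      exact ⟨inv_pos.2 (lt_trans one_pos hx), inv_lt_one_of_one_lt₀ hx⟩
    · rintro ⟨h0, h1⟩
      exact ⟨y⁻¹, (one_lt_inv₀ h0).2 h1, inv_inv y⟩
  rw [← him, lintegral_image_eq_lintegral_abs_deriv_mul measurableSet_Ioi
    (fun x hx => (hasDerivAt_inv (lt_trans one_pos hx).ne').hasDerivWithinAt)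
    (fun x _ y _ h => inv_injective h)]
  refine setLIntegral_congr_fun measurableSet_Ioi fun x hx => ?_
  have hx0 : (0 : ℝ) < x := lt_trans one_pos hx
  rw [← ENNReal.ofReal_mul (abs_nonneg _), abs_neg, abs_of_pos (by positivity), Real.log_inv]
  congr 1
  rw [inv_pow]
  field_simp
  ring

/-- `∫₀^∞ z^{-(N+1)} min(m,z)^N min(z,L)^N dz` -/
lemma lint_mid (n : ℕ) {m L : ℝ} (hm : 0 < m) (hL : m ≤ L) :
    ∫⁻ z in Set.Ioi (0 : ℝ), ENNReal.ofReal
      ((z ^ (n + 2))⁻¹ * min m z ^ (n + 1) * min z L ^ (n + 1)) =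
      ENNReal.ofReal (m ^ (n + 1) * (2 / (n + 1) + Real.log (L / m))) := by
  have hL0 : 0 < L := hm.trans_le hL
  have hset : Set.Ioi (0 : ℝ) = (Set.Ioc 0 m ∪ Set.Ioc m L) ∪ Set.Ioi L := by
    rw [Set.Ioc_union_Ioc_eq_Ioc hm.le hL, Set.Ioc_union_Ioi_eq_Ioi hL0.le]
  rw [hset, lintegral_union measurableSet_Ioi, lintegral_union measurableSet_Ioc]
  · have i1 : ∫⁻ z in Set.Ioc 0 m, ENNReal.ofReal
        ((z ^ (n + 2))⁻¹ * min m z ^ (n + 1) * min z L ^ (n + 1)) =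
        ENNReal.ofReal (m ^ (n + 1) / (n + 1)) := by
      rw [← lint_pow n hm.le]
      refine setLIntegral_congr_fun measurableSet_Ioc fun z hz => ?_
      have hz0 : 0 < z := hz.1
      rw [min_eq_right hz.2, min_eq_left (hz.2.trans hL)]
      congr 1
      field_simp
      ring
    have i2 : ∫⁻ z in Set.Ioc m L, ENNReal.ofReal
        ((z ^ (n + 2))⁻¹ * min m z ^ (n + 1) * min z L ^ (n + 1)) =
        ENNReal.ofReal (m ^ (n + 1) * Real.log (L / m)) := by
      rw [← lint_inv hm hL (pow_nonneg hm.le _)]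
      refine setLIntegral_congr_fun measurableSet_Ioc fun z hz => ?_
      have hz0 : 0 < z := hm.trans hz.1
      rw [min_eq_left hz.1.le, min_eq_left hz.2]
      congr 1
      field_simp
      ring
    have i3 : ∫⁻ z in Set.Ioi L, ENNReal.ofReal
        ((z ^ (n + 2))⁻¹ * min m z ^ (n + 1) * min z L ^ (n + 1)) =
        ENNReal.ofReal (m ^ (n + 1) * L ^ (n + 1) / ((n + 1) * L ^ (n + 1))) := by
      rw [← lint_tail n hL0 (by positivity)]
      refine setLIntegral_congr_fun measurableSet_Ioi fun z hz => ?_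
      have hz' : L < z := hz
      rw [min_eq_left (hL.trans hz'.le), min_eq_right hz'.le]
      congr 1
      ring
    have hlog : 0 ≤ Real.log (L / m) := Real.log_nonneg ((one_le_div hm).2 hL)
    rw [i1, i2, i3, ← ENNReal.ofReal_add (by positivity) (by positivity),
      ← ENNReal.ofReal_add (by positivity) (by positivity)]
    congr 1
    field_simp
    ring
  · rw [Set.disjoint_left]
    intro z h1 h2
    exact absurd h2.1 (not_lt.2 h1.2)
  · rw [Set.disjoint_left]
    intro z h1 h2
    have h2' : L < z := h2
    rcases h1 with h1 | h1
    · have := h1.2; linarith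
    · have := h1.2; linarith

lemma lint_mid_one (n : ℕ) {x : ℝ} (hx : 0 < x) :
    ∫⁻ z in Set.Ioi (0 : ℝ), ENNReal.ofReal
      ((z ^ (n + 2))⁻¹ * min 1 z ^ (n + 1) * min z x ^ (n + 1)) =
      ENNReal.ofReal (min 1 x ^ (n + 1) * (2 / (n + 1) + |Real.log x|)) := by
  rcases le_total 1 x with h | h
  · rw [lint_mid n one_pos h, min_eq_left h, abs_of_nonneg (Real.log_nonneg h), div_one]
  · rw [min_eq_right h, abs_of_nonpos (Real.log_nonpos hx.le h), ← Real.log_inv, ← one_div,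
      ← lint_mid n hx h]
    refine lintegral_congr fun z => ?_
    rw [min_comm 1 z, min_comm z x]
    congr 1
    ring

lemma lint_final (n : ℕ) :
    ∫⁻ x in Set.Ioi (0 : ℝ), ENNReal.ofReal
      ((x ^ (n + 2))⁻¹ * (min 1 x ^ (n + 1) * (2 / (n + 1) + |Real.log x|)) ^ 2) =
      ENNReal.ofReal (20 / ((n : ℝ) + 1) ^ 3) := by
  have hset : Set.Ioi (0 : ℝ) = Set.Ioc 0 1 ∪ Set.Ioi 1 := by
    rw [Set.Ioc_union_Ioi_eq_Ioi zero_le_one]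
  rw [hset, lintegral_union measurableSet_Ioi]
  · have i1 : ∫⁻ x in Set.Ioc (0 : ℝ) 1, ENNReal.ofReal
        ((x ^ (n + 2))⁻¹ * (min 1 x ^ (n + 1) * (2 / (n + 1) + |Real.log x|)) ^ 2) =
        ENNReal.ofReal (10 / ((n : ℝ) + 1) ^ 3) := by
      rw [← lint_final_head n, ← setLIntegral_congr Ioo_ae_eq_Ioc]
      refine setLIntegral_congr_fun measurableSet_Ioo fun x hx => ?_
      have hx0 : 0 < x := hx.1
      rw [min_eq_right hx.2.le, abs_of_nonpos (Real.log_nonpos hx0.le hx.2.le), ← sub_eq_add_neg]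
      congr 1
      rw [mul_pow, ← mul_assoc]
      congr 1
      field_simp
      ring
    have i2 : ∫⁻ x in Set.Ioi (1 : ℝ), ENNReal.ofReal
        ((x ^ (n + 2))⁻¹ * (min 1 x ^ (n + 1) * (2 / (n + 1) + |Real.log x|)) ^ 2) =
        ENNReal.ofReal (10 / ((n : ℝ) + 1) ^ 3) := by
      rw [← lint_final_tail n]
      refine setLIntegral_congr_fun measurableSet_Ioi fun x hx => ?_
      have hx1 : (1 : ℝ) < x := hx
      rw [min_eq_left hx1.le, abs_of_nonneg (Real.log_nonneg hx1.le), one_pow, one_mul]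
    rw [i1, i2, ← ENNReal.ofReal_add (by positivity) (by positivity)]
    congr 1
    ring
  · rw [Set.disjoint_left]
    intro z h1 h2
    exact absurd h2 (not_lt.2 h1.2)

/-- weight of the `Z` variables -/
noncomputable def wC (n : ℕ) (z : ℝ) : ENNReal :=
  (Set.Ioi 0).indicator (fun z => ENNReal.ofReal (z ^ (n + 2))⁻¹) z

/-- weight of the `t` variables -/
noncomputable def wA (n : ℕ) (u v t : ℝ) : ENNReal :=
  (Set.Ioo 0 (min u v)).indicator (fun t => ENNReal.ofReal (t ^ n)) t

/-- integrated weight of a `t` variable -/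
noncomputable def wM (n : ℕ) (u v : ℝ) : ENNReal :=
  ENNReal.ofReal (max 0 (min u v) ^ (n + 1) / (n + 1))

lemma lint_wA (n : ℕ) (u v : ℝ) : ∫⁻ t, wA n u v t = wM n u v := by
  unfold wA wM
  rw [lintegral_indicator measurableSet_Ioo]
  rcases le_total 0 (min u v) with h | h
  · rw [max_eq_right h, ← lint_pow n h, ← setLIntegral_congr Ioo_ae_eq_Ioc]
  · rw [max_eq_left h, Set.Ioo_eq_empty (not_lt.2 h)]
    simp

lemma indicator_dom (n : ℕ) (a b c d e g h : ℝ) :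
    dom.indicator (fun x => ENNReal.ofReal
      ((x 3 * x 4 * x 5 * x 6) ^ n / (x 0 * x 1 * x 2) ^ (n + 2))) ![a, b, c, d, e, g, h] =
    wC n a * ((wC n b * (wC n c * (wA n 1 b d * (wA n b a e * (wA n a c g * wA n c 1 h)))))) := by
  by_cases hx : ![a, b, c, d, e, g, h] ∈ dom
  · rw [Set.indicator_of_mem hx]
    obtain ⟨⟨h0, h1, h2⟩, ⟨h3, h31, h32⟩, ⟨h4, h41, h42⟩, ⟨h5, h51, h52⟩, ⟨h6, h61, h62⟩⟩ := hx
    simp only [Matrix.cons_val, Matrix.cons_val_zero, Matrix.cons_val_one] at *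
    unfold wC wA
    rw [Set.indicator_of_mem (by exact h0), Set.indicator_of_mem (by exact h1),
      Set.indicator_of_mem (by exact h2), Set.indicator_of_mem (by exact ⟨h3, lt_min h31 h32⟩),
      Set.indicator_of_mem (by exact ⟨h4, lt_min h41 h42⟩),
      Set.indicator_of_mem (by exact ⟨h5, lt_min h51 h52⟩),
      Set.indicator_of_mem (by exact ⟨h6, lt_min h61 h62⟩)]
    rw [← ENNReal.ofReal_mul (by positivity), ← ENNReal.ofReal_mul (by positivity),
      ← ENNReal.ofReal_mul (by positivity), ← ENNReal.ofReal_mul (by positivity),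
      ← ENNReal.ofReal_mul (by positivity), ← ENNReal.ofReal_mul (by positivity)]
    congr 1
    field_simp
    ring
  · rw [Set.indicator_of_notMem hx]
    symm
    by_contra hne
    apply hx
    have hC : ∀ z, wC n z ≠ 0 → 0 < z := fun z hz => by
      by_contra hcon
      exact hz (Set.indicator_of_notMem (by exact hcon) _)
    have hA : ∀ u v t, wA n u v t ≠ 0 → 0 < t ∧ t < u ∧ t < v := fun u v t hz => by
      by_contra hcon
      refine hz (Set.indicator_of_notMem (fun hmem => hcon ?_) _)
      exact ⟨hmem.1, lt_min_iff.1 hmem.2⟩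
    simp only [mul_ne_zero_iff, ← ne_eq] at hne
    obtain ⟨k0, k1, k2, k3, k4, k5, k6⟩ := hne
    exact ⟨⟨hC _ k0, hC _ k1, hC _ k2⟩, hA _ _ _ k3, hA _ _ _ k4, hA _ _ _ k5, hA _ _ _ k6⟩

lemma wC_ne_top (n : ℕ) (z : ℝ) : wC n z ≠ ⊤ := by
  unfold wC Set.indicator
  split_ifs <;> simp

lemma wA_ne_top (n : ℕ) (u v t : ℝ) : wA n u v t ≠ ⊤ := by
  unfold wA Set.indicator
  split_ifs <;> simp

lemma wM_ne_top (n : ℕ) (u v : ℝ) : wM n u v ≠ ⊤ := ENNReal.ofReal_ne_top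

lemma wM_comm (n : ℕ) (u v : ℝ) : wM n u v = wM n v u := by
  unfold wM
  rw [min_comm]

lemma lint_wK (n : ℕ) {x : ℝ} (hx : 0 < x) :
    ∫⁻ z, wC n z * (wM n 1 z * wM n z x) =
      ENNReal.ofReal (min 1 x ^ (n + 1) * (2 / (n + 1) + |Real.log x|) / ((n : ℝ) + 1) ^ 2) := by
  have e : ∀ z, wC n z * (wM n 1 z * wM n z x) = (Set.Ioi (0 : ℝ)).indicator (fun z =>
      ENNReal.ofReal (1 / ((n : ℝ) + 1) ^ 2) * ENNReal.ofReal
      ((z ^ (n + 2))⁻¹ * min 1 z ^ (n + 1) * min z x ^ (n + 1))) z := by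
    intro z
    unfold wC wM
    by_cases hz : z ∈ Set.Ioi (0 : ℝ)
    · have hz0 : 0 < z := hz
      rw [Set.indicator_of_mem hz, Set.indicator_of_mem hz]
      have h1 : 0 < min 1 z := lt_min one_pos hz0
      have h2 : 0 < min z x := lt_min hz0 hx
      rw [max_eq_right h1.le, max_eq_right h2.le, ← ENNReal.ofReal_mul (by positivity),
        ← ENNReal.ofReal_mul (by positivity), ← ENNReal.ofReal_mul (by positivity)]
      congr 1
      field_simp
    · rw [Set.indicator_of_notMem hz, Set.indicator_of_notMem hz, zero_mul]
  rw [lintegral_congr e, lintegral_indicator measurableSet_Ioi,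
    lintegral_const_mul' _ _ ENNReal.ofReal_ne_top, lint_mid_one n hx,
    ← ENNReal.ofReal_mul (by positivity)]
  congr 1
  ring

lemma lint_wA_mul (n : ℕ) (u v : ℝ) {k : ENNReal} (hk : k ≠ ⊤) :
    ∫⁻ t, wA n u v t * k = wM n u v * k := by
  rw [lintegral_mul_const' _ _ hk, lint_wA]

lemma lint_dom (n : ℕ) :
    ∫⁻ x in dom, ENNReal.ofReal ((x 3 * x 4 * x 5 * x 6) ^ n / (x 0 * x 1 * x 2) ^ (n + 2)) =
      ENNReal.ofReal (20 / ((n : ℝ) + 1) ^ 7) := by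
  rw [← lintegral_indicator measurableSet_dom, lintegral_seven]
  swap
  · refine Measurable.indicator ?_ measurableSet_dom
    fun_prop
  simp only [indicator_dom]
  have e : ∀ a : ℝ, (∫⁻ b : ℝ, ∫⁻ c : ℝ, ∫⁻ d : ℝ, ∫⁻ e : ℝ, ∫⁻ g : ℝ, ∫⁻ h : ℝ,
      wC n a * ((wC n b * (wC n c * (wA n 1 b d * (wA n b a e * (wA n a c g * wA n c 1 h))))))) =
      (Set.Ioi (0 : ℝ)).indicator (fun x => ENNReal.ofReal (1 / ((n : ℝ) + 1) ^ 4) *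
        ENNReal.ofReal ((x ^ (n + 2))⁻¹ *
          (min 1 x ^ (n + 1) * (2 / (n + 1) + |Real.log x|)) ^ 2)) a := by
    intro a
    by_cases ha : a ∈ Set.Ioi (0 : ℝ)
    · have ha0 : 0 < a := ha
      have s1 : ∀ b c : ℝ, (∫⁻ d : ℝ, ∫⁻ e : ℝ, ∫⁻ g : ℝ, ∫⁻ h : ℝ,
          wC n a * ((wC n b * (wC n c * (wA n 1 b d * (wA n b a e * (wA n a c g * wA n c 1 h)))))))
          = (wC n a * (wC n b * (wM n 1 b * wM n b a))) * (wC n c * (wM n 1 c * wM n c a)) := by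
        intro b c
        simp only [lintegral_const_mul' _ _ (wC_ne_top n _),
          lintegral_const_mul' _ _ (wA_ne_top n _ _ _), lint_wA]
        simp only [lint_wA_mul n _ _ (wM_ne_top n c 1)]
        simp only [lint_wA_mul n _ _ (ENNReal.mul_ne_top (wM_ne_top n a c) (wM_ne_top n c 1))]
        simp only [lint_wA_mul n _ _ (ENNReal.mul_ne_top (wM_ne_top n b a)
          (ENNReal.mul_ne_top (wM_ne_top n a c) (wM_ne_top n c 1)))]
        rw [wM_comm n c 1, wM_comm n a c]
        ring
      have t1 : ∀ b : ℝ, wC n a * (wC n b * (wM n 1 b * wM n b a)) ≠ ⊤ := fun b =>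
        ENNReal.mul_ne_top (wC_ne_top n a) (ENNReal.mul_ne_top (wC_ne_top n b)
          (ENNReal.mul_ne_top (wM_ne_top n _ _) (wM_ne_top n _ _)))
      simp only [s1]
      simp only [lintegral_const_mul' _ _ (t1 _), lint_wK n ha0]
      rw [lintegral_mul_const' _ _ ENNReal.ofReal_ne_top, lintegral_const_mul' _ _ (wC_ne_top n a),
        lint_wK n ha0, Set.indicator_of_mem ha]
      unfold wC
      rw [Set.indicator_of_mem ha]
      have hmin : 0 < min 1 a := lt_min one_pos ha0
      rw [← ENNReal.ofReal_mul (by positivity), ← ENNReal.ofReal_mul (by positivity),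
        ← ENNReal.ofReal_mul (by positivity)]
      congr 1
      field_simp
    · have h0 : wC n a = 0 := Set.indicator_of_notMem ha _
      rw [Set.indicator_of_notMem ha, h0]
      simp
  rw [lintegral_congr e, lintegral_indicator measurableSet_Ioi,
    lintegral_const_mul' _ _ ENNReal.ofReal_ne_top, lint_final n,
    ← ENNReal.ofReal_mul (by positivity)]
  congr 1
  field_simp

lemma measurable_integrand :
    Measurable (fun α : Fin 7 → ℝ => (symanzikU (Fin.snoc α 1) ^ 2)⁻¹) := by
  have hs : ∀ i : Fin 8, Measurable (fun α : Fin 7 → ℝ => (Fin.snoc α 1 : Fin 8 → ℝ) i) := by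
    intro i
    refine Fin.lastCases ?_ (fun j => ?_) i
    · simp only [Fin.snoc_last]
      exact measurable_const
    · simp only [Fin.snoc_castSucc]
      exact measurable_pi_apply j
  refine Measurable.inv (Measurable.pow_const ?_ 2)
  unfold symanzikU
  refine Finset.measurable_fun_sum _ fun T _ => ?_
  by_cases hT : IsSpanningTree T
  · simp only [hT, if_true]
    exact Finset.measurable_fun_prod _ fun i _ => hs i
  · simp only [hT, if_false]
    exact measurable_const

lemma summable_zeta5 : Summable (fun k : ℕ => 1 / ((k : ℝ) + 1) ^ 5) := by
  have h := (summable_nat_add_iff 1).2 (Real.summable_one_div_nat_pow.2 (by norm_num : 1 < 5))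
  simpa using h

lemma zeta5_nonneg : 0 ≤ zeta5 := tsum_nonneg fun k => by positivity

lemma lintegral_total :
    ∫⁻ α in {α : Fin 7 → ℝ | ∀ i, 0 < α i},
      ENNReal.ofReal ((symanzikU (Fin.snoc α 1) ^ 2)⁻¹) = ENNReal.ofReal (20 * zeta5) := by
  rw [lintegral_cov]
  simp only [lint_dom]
  unfold zeta5
  rw [← tsum_mul_left, ENNReal.ofReal_tsum_of_nonneg (fun n => by positivity)
    (summable_zeta5.mul_left 20)]
  refine tsum_congr fun n => ?_
  rw [← ENNReal.ofReal_mul (by positivity)]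
  congr 1
  field_simp

/-- The wheel-with-four-spokes period: `∫_{(0,∞)⁷} U(α₁,…,α₇,1)⁻² dα₁⋯dα₇ = 20 ζ(5)`,
the integral converging absolutely. -/
theorem stmt17 :
    IntegrableOn (fun α : Fin 7 → ℝ => (symanzikU (Fin.snoc α 1) ^ 2)⁻¹)
      {α : Fin 7 → ℝ | ∀ i, 0 < α i} ∧
    (∫ α in {α : Fin 7 → ℝ | ∀ i, 0 < α i}, (symanzikU (Fin.snoc α 1) ^ 2)⁻¹) =
      20 * zeta5 := by
  have hnn : ∀ α : Fin 7 → ℝ, 0 ≤ (symanzikU (Fin.snoc α 1) ^ 2)⁻¹ := fun α => by positivity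
  have hm := measurable_integrand
  constructor
  · refine ⟨hm.aestronglyMeasurable, ?_⟩
    rw [hasFiniteIntegral_iff_ofReal (Filter.Eventually.of_forall hnn), lintegral_total]
    exact ENNReal.ofReal_lt_top
  · rw [integral_eq_lintegral_of_nonneg_ae (Filter.Eventually.of_forall hnn)
      hm.aestronglyMeasurable, lintegral_total,
      ENNReal.toReal_ofReal (mul_nonneg (by norm_num) zeta5_nonneg)]
end
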